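/- arXiv:1012.1163 — 4 statements merged into one kernel-verified Lean document; each statement's English description precedes it below -/
import Mathlib

section
/- There is a constant c > 0 such that the following holds for all reals φ > 1 and all positive integers n_p, n_q. Let m_i = ((n_p+1)/(φ-1)) · ((2φ-1)/(φ-1))^{i-1} and k_i = ⌈m_i⌉ for i = 1,...,n_q. Let a_1,...,a_{n_p} have weights 2^1,...,2^{n_p} and profits p_i drawn independently and uniformly from [0, 1/φ], and for each i = 1,...,n_q and l = 1,...,k_i let b_i^{(l)} have weight 2^{n_p+i}/k_i and profit q_i^{(l)} drawn independently and uniformly from (m_i/k_i − 1/φ, m_i/k_i]. Let the solution set be S := {0,1}^{n_p} × Π_{i=1}^{n_q} S_i with S_i = {(0,...,0),(1,...,1)} ⊆ {0,1}^{k_i}. Then the expected number of Pareto optimal solutions of K_S over all these objects is at least c · n_p² · 2^{n_q}. -/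
open MeasureTheory Finset

/-- Total weight (or total profit) of a 0-1 solution `s`. -/
def totalVal {ι : Type*} [Fintype ι] (w : ι → ℝ) (s : ι → Bool) : ℝ :=
  ∑ i, if s i then w i else 0

/-- `s'` dominates `s`: it is no heavier, has no smaller profit, and is strictly
better in at least one of the two criteria. -/
def dominates {ι : Type*} [Fintype ι] (w p : ι → ℝ) (s' s : ι → Bool) : Prop :=
  totalVal w s' ≤ totalVal w s ∧ totalVal p s ≤ totalVal p s' ∧
    (totalVal w s' < totalVal w s ∨ totalVal p s < totalVal p s')

/-- Pareto set of the bi-criteria knapsack problem with solution set `S`,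
weights `w` and profits `p`. -/
def paretoSet {ι : Type*} [Fintype ι] (S : Set (ι → Bool)) (w p : ι → ℝ) :
    Set (ι → Bool) :=
  {s ∈ S | ∀ s' ∈ S, ¬ dominates w p s' s}

/-- The uniform probability measure on a set of reals. -/
noncomputable def unifOn (s : Set ℝ) : Measure ℝ :=
  (volume s)⁻¹ • volume.restrict s

/-- The sets of objects among the first `n` that are Pareto optimal for weights `w` and
profits `r`. -/
noncomputable def paretoSubsets (w r : ℕ → ℝ) (n : ℕ) : Finset (Finset ℕ) :=
  open Classical in
  (range n).powerset.filter fun A => ∀ B ⊆ range n,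
    ¬ (∑ i ∈ B, w i ≤ ∑ i ∈ A, w i ∧ ∑ i ∈ A, r i ≤ ∑ i ∈ B, r i ∧
      (∑ i ∈ B, w i < ∑ i ∈ A, w i ∨ ∑ i ∈ A, r i < ∑ i ∈ B, r i))

lemma mem_paretoSubsets {w r : ℕ → ℝ} {n : ℕ} {A : Finset ℕ} :
    A ∈ paretoSubsets w r n ↔ A ⊆ range n ∧ ∀ B ⊆ range n,
      ¬ (∑ i ∈ B, w i ≤ ∑ i ∈ A, w i ∧ ∑ i ∈ A, r i ≤ ∑ i ∈ B, r i ∧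
        (∑ i ∈ B, w i < ∑ i ∈ A, w i ∨ ∑ i ∈ A, r i < ∑ i ∈ B, r i)) := by
  simp [paretoSubsets]

/-- The Pareto optimal sets among the first `n` objects whose profit is less than `x` below
the total profit. -/
noncomputable def nearTop (w r : ℕ → ℝ) (n : ℕ) (x : ℝ) : Finset (Finset ℕ) :=
  (paretoSubsets w r n).filter fun A => ∑ i ∈ range n, r i - ∑ i ∈ A, r i < x

lemma erase_subset_range {n : ℕ} {B : Finset ℕ} (hB : B ⊆ range (n + 1)) :
    B.erase n ⊆ range n := by
  intro i hi
  have h1 := hB (mem_of_mem_erase hi)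
  have h2 := ne_of_mem_erase hi
  simp only [mem_range] at *
  omega

lemma notMem_of_subset_range {n : ℕ} {A : Finset ℕ} (hA : A ⊆ range n) : n ∉ A :=
  fun h => notMem_range_self (hA h)

section Step

variable {w r : ℕ → ℝ} {n : ℕ}

lemma paretoSubsets_subset_succ (hw0 : ∀ i, 0 ≤ w i) (hw : ∑ i ∈ range n, w i < w n) :
    paretoSubsets w r n ⊆ paretoSubsets w r (n + 1) := by
  intro A hA
  rw [mem_paretoSubsets] at hA ⊢
  refine ⟨hA.1.trans (range_mono n.le_succ), fun B hB hdom => ?_⟩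
  by_cases hn : n ∈ B
  · have h1 : w n ≤ ∑ i ∈ B, w i := single_le_sum (fun i _ => hw0 i) hn
    have h2 : ∑ i ∈ A, w i ≤ ∑ i ∈ range n, w i :=
      sum_le_sum_of_subset_of_nonneg hA.1 fun i _ _ => hw0 i
    linarith [hdom.1]
  · exact hA.2 B (by simpa [erase_eq_of_notMem hn] using erase_subset_range hB) hdom

lemma insert_mem_paretoSubsets (hr : ∀ i < n, 0 ≤ r i) {A : Finset ℕ}
    (hA : A ∈ paretoSubsets w r n) (htop : ∑ i ∈ range n, r i - ∑ i ∈ A, r i < r n) :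
    insert n A ∈ paretoSubsets w r (n + 1) := by
  rw [mem_paretoSubsets] at hA ⊢
  have hnA := notMem_of_subset_range hA.1
  refine ⟨?_, fun B hB hdom => ?_⟩
  · rw [range_add_one]
    exact insert_subset_insert n hA.1
  rw [sum_insert hnA, sum_insert hnA] at hdom
  by_cases hn : n ∈ B
  · refine hA.2 (B.erase n) (erase_subset_range hB) ?_
    have h1 := sum_erase_add B w hn
    have h2 := sum_erase_add B r hn
    refine ⟨by linarith [hdom.1], by linarith [hdom.2.1], ?_⟩
    exact hdom.2.2.imp (fun h => by linarith) fun h => by linarith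
  · have hBn : B ⊆ range n := by simpa [erase_eq_of_notMem hn] using erase_subset_range hB
    have h2 : ∑ i ∈ B, r i ≤ ∑ i ∈ range n, r i :=
      sum_le_sum_of_subset_of_nonneg hBn fun i hi _ => hr i (mem_range.1 hi)
    linarith [hdom.2.1]

lemma card_add_card_image_insert {S T U : Finset (Finset ℕ)} (hS : ∀ A ∈ S, A ⊆ range n)
    (hT : ∀ A ∈ T, A ⊆ range n) (hSU : S ⊆ U) (hTU : ∀ A ∈ T, insert n A ∈ U) :
    #S + #T ≤ #U := by
  have hinj : Set.InjOn (insert n : Finset ℕ → Finset ℕ) T := by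
    intro A hA B hB h
    rw [← erase_insert (notMem_of_subset_range (hT A hA)), h,
      erase_insert (notMem_of_subset_range (hT B hB))]
  have hdisj : Disjoint S (T.image (insert n)) := by
    rw [disjoint_left]
    intro A hA hA'
    obtain ⟨B, -, rfl⟩ := mem_image.1 hA'
    exact notMem_of_subset_range (hS _ hA) (mem_insert_self n B)
  rw [← card_image_of_injOn hinj, ← card_union_of_disjoint hdisj]
  refine card_le_card (union_subset hSU ?_)
  simpa [image_subset_iff] using hTU

lemma card_paretoSubsets_succ (hw0 : ∀ i, 0 ≤ w i) (hw : ∑ i ∈ range n, w i < w n)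
    (hr : ∀ i < n, 0 ≤ r i) :
    #(paretoSubsets w r n) + #(nearTop w r n (r n)) ≤ #(paretoSubsets w r (n + 1)) := by
  refine card_add_card_image_insert (fun A hA => (mem_paretoSubsets.1 hA).1)
    (fun A hA => (mem_paretoSubsets.1 (mem_filter.1 hA).1).1)
    (paretoSubsets_subset_succ hw0 hw) fun A hA => ?_
  exact insert_mem_paretoSubsets hr (mem_filter.1 hA).1 (mem_filter.1 hA).2

lemma card_nearTop_succ (hw0 : ∀ i, 0 ≤ w i) (hw : ∑ i ∈ range n, w i < w n)
    (hr : ∀ i < n, 0 ≤ r i) (x : ℝ) :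
    #(nearTop w r n (x - r n)) + #(nearTop w r n (min x (r n))) ≤
      #(nearTop w r (n + 1) x) := by
  refine card_add_card_image_insert (fun A hA => (mem_paretoSubsets.1 (mem_filter.1 hA).1).1)
    (fun A hA => (mem_paretoSubsets.1 (mem_filter.1 hA).1).1) (fun A hA => ?_) fun A hA => ?_
  · rw [nearTop, mem_filter] at hA ⊢
    refine ⟨paretoSubsets_subset_succ hw0 hw hA.1, ?_⟩
    rw [sum_range_succ]
    linarith [hA.2]
  · rw [nearTop, mem_filter] at hA ⊢
    rw [lt_min_iff] at hA
    refine ⟨insert_mem_paretoSubsets hr hA.1 hA.2.2, ?_⟩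
    rw [sum_range_succ, sum_insert (notMem_of_subset_range (mem_paretoSubsets.1 hA.1).1)]
    linarith [hA.2.1]

lemma two_mul_card_paretoSubsets_le (hw0 : ∀ i, 0 ≤ w i) (hw : ∑ i ∈ range n, w i < w n)
    (hr : ∀ i < n, 0 ≤ r i) (hlarge : ∑ i ∈ range n, r i < r n) :
    2 * #(paretoSubsets w r n) ≤ #(paretoSubsets w r (n + 1)) := by
  have h : nearTop w r n (r n) = paretoSubsets w r n := by
    refine filter_true_of_mem fun A hA => ?_
    have : 0 ≤ ∑ i ∈ A, r i :=
      sum_nonneg fun i hi => hr i (mem_range.1 ((mem_paretoSubsets.1 hA).1 hi))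
    linarith
  have := card_paretoSubsets_succ hw0 hw hr
  rw [h] at this
  omega

end Step

lemma paretoSubsets_zero (w r : ℕ → ℝ) : paretoSubsets w r 0 = {∅} := by
  ext A
  rw [mem_paretoSubsets]
  simp only [range_zero, subset_empty, mem_singleton]
  constructor
  · exact fun h => h.1
  · rintro rfl
    simp

/-- A recursively computed lower bound for the cardinality of `nearTop`. -/
noncomputable def nearTopBound : (n : ℕ) → (Fin n → ℝ) → ℝ → ENNReal
  | 0, _, x => if 0 < x then 1 else 0
  | n + 1, r, x =>
    nearTopBound n (fun i => r i.castSucc) (x - r (Fin.last n)) +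
      nearTopBound n (fun i => r i.castSucc) (min x (r (Fin.last n)))

/-- A recursively computed lower bound for the cardinality of `paretoSubsets`. -/
noncomputable def paretoBound : (n : ℕ) → (Fin n → ℝ) → ENNReal
  | 0, _ => 1
  | n + 1, r =>
    paretoBound n (fun i => r i.castSucc) +
      nearTopBound n (fun i => r i.castSucc) (r (Fin.last n))

lemma nearTopBound_le {w r : ℕ → ℝ} (hw0 : ∀ i, 0 ≤ w i)
    (hw : ∀ n, ∑ i ∈ range n, w i < w n) (n : ℕ) (hr : ∀ i < n, 0 ≤ r i) (x : ℝ) :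
    nearTopBound n (fun i => r i) x ≤ #(nearTop w r n x) := by
  induction n generalizing x with
  | zero =>
    simp only [nearTopBound, nearTop, paretoSubsets_zero, filter_singleton]
    split_ifs <;> simp_all
  | succ n ih =>
    have hr' : ∀ i < n, 0 ≤ r i := fun i hi => hr i (by omega)
    refine (add_le_add (ih hr' (x - r n)) (ih hr' (min x (r n)))).trans ?_
    exact_mod_cast card_nearTop_succ hw0 (hw n) hr' x

lemma paretoBound_le {w r : ℕ → ℝ} (hw0 : ∀ i, 0 ≤ w i)
    (hw : ∀ n, ∑ i ∈ range n, w i < w n) (n : ℕ) (hr : ∀ i < n, 0 ≤ r i) :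
    paretoBound n (fun i => r i) ≤ #(paretoSubsets w r n) := by
  induction n with
  | zero => simp [paretoBound, paretoSubsets_zero]
  | succ n ih =>
    have hr' : ∀ i < n, 0 ≤ r i := fun i hi => hr i (by omega)
    refine (add_le_add (ih hr') (nearTopBound_le hw0 hw n hr' (r n))).trans ?_
    exact_mod_cast card_paretoSubsets_succ hw0 (hw n) hr'

lemma measurable_nearTopBound (n : ℕ) :
    Measurable fun z : (Fin n → ℝ) × ℝ => nearTopBound n z.1 z.2 := by
  induction n with
  | zero =>
    exact Measurable.ite (measurableSet_lt measurable_const measurable_snd)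
      measurable_const measurable_const
  | succ n ih =>
    have h1 : Measurable fun z : (Fin (n + 1) → ℝ) × ℝ =>
        ((fun i : Fin n => z.1 i.castSucc), z.2 - z.1 (Fin.last n)) := by fun_prop
    have h2 : Measurable fun z : (Fin (n + 1) → ℝ) × ℝ =>
        ((fun i : Fin n => z.1 i.castSucc), min z.2 (z.1 (Fin.last n))) := by fun_prop
    exact (ih.comp h1).add (ih.comp h2)

lemma measurable_paretoBound (n : ℕ) : Measurable (paretoBound n) := by
  induction n with
  | zero => exact measurable_const
  | succ n ih =>
    have h1 : Measurable fun r : Fin (n + 1) → ℝ => fun i : Fin n => r i.castSucc := by fun_prop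
    have h2 : Measurable fun r : Fin (n + 1) → ℝ =>
        ((fun i : Fin n => r i.castSucc), r (Fin.last n)) := by fun_prop
    exact (ih.comp h1).add ((measurable_nearTopBound n).comp h2)

lemma lintegral_pi_succ_last (ν : Measure ℝ) [IsProbabilityMeasure ν] {n : ℕ}
    {f : ℝ → (Fin n → ℝ) → ENNReal} (hf : Measurable fun z : ℝ × (Fin n → ℝ) => f z.1 z.2) :
    ∫⁻ r, f (r (Fin.last n)) (fun i => r i.castSucc) ∂Measure.pi (fun _ : Fin (n + 1) => ν) =
      ∫⁻ t, ∫⁻ r, f t r ∂Measure.pi (fun _ : Fin n => ν) ∂ν := by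
  have h := measurePreserving_piFinSuccAbove (fun _ : Fin (n + 1) => ν) (Fin.last n)
  rw [← lintegral_prod (fun z : ℝ × (Fin n → ℝ) => f z.1 z.2) hf.aemeasurable,
    ← h.lintegral_comp hf]
  refine lintegral_congr fun r => ?_
  simp [MeasurableEquiv.piFinSuccAbove, Fin.insertNthEquiv, Fin.init_def]

lemma isProbabilityMeasure_unifOn {s : Set ℝ} (h0 : volume s ≠ 0) (htop : volume s ≠ ⊤) :
    IsProbabilityMeasure (unifOn s) :=
  ⟨by simp [unifOn, ENNReal.inv_mul_cancel h0 htop]⟩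

lemma ae_unifOn_mem {s : Set ℝ} (hs : MeasurableSet s) : ∀ᵐ t ∂unifOn s, t ∈ s :=
  Measure.ae_smul_measure (ae_restrict_mem hs) _

lemma unifOn_Icc_apply {φ : ℝ} (hφ : 0 < φ) {x y : ℝ} (hx : 0 ≤ x) (hy : y ≤ 1 / φ) :
    unifOn (Set.Icc 0 (1 / φ)) (Set.Ioo x y) = ENNReal.ofReal (φ * (y - x)) := by
  have : Set.Ioo x y ∩ Set.Icc 0 (1 / φ) = Set.Ioo x y := by
    refine Set.inter_eq_left.2 fun t ht => ⟨hx.trans ht.1.le, ht.2.le.trans hy⟩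
  rw [unifOn, Measure.smul_apply, Measure.restrict_apply measurableSet_Ioo, this,
    Real.volume_Icc, Real.volume_Ioo, sub_zero, smul_eq_mul, one_div,
    ENNReal.ofReal_inv_of_pos hφ, inv_inv, ENNReal.ofReal_mul hφ.le]

lemma isProbabilityMeasure_unifOn_Icc {φ : ℝ} (hφ : 0 < φ) :
    IsProbabilityMeasure (unifOn (Set.Icc 0 (1 / φ))) := by
  refine isProbabilityMeasure_unifOn ?_ ?_ <;> simp [hφ]

lemma le_lintegral_nearTopBound {φ : ℝ} (hφ : 0 < φ) (n : ℕ) {x : ℝ} (hx : 0 < x)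
    (hx' : x ≤ 1 / φ) :
    ENNReal.ofReal (1 + n * φ * x) ≤
      ∫⁻ r, nearTopBound n r x
        ∂Measure.pi (fun _ : Fin n => unifOn (Set.Icc 0 (1 / φ))) := by
  have := isProbabilityMeasure_unifOn_Icc hφ
  induction n generalizing x with
  | zero => simp [nearTopBound, hx]
  | succ n ih =>
    have hm1 (y : ℝ) : Measurable fun r : Fin n → ℝ => nearTopBound n r y :=
      (measurable_nearTopBound n).comp (measurable_id.prodMk measurable_const)
    have hm : Measurable fun z : ℝ × (Fin n → ℝ) =>
        nearTopBound n z.2 (x - z.1) + nearTopBound n z.2 (min x z.1) := by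
      have h1 : Measurable fun z : ℝ × (Fin n → ℝ) => (z.2, x - z.1) := by fun_prop
      have h2 : Measurable fun z : ℝ × (Fin n → ℝ) => (z.2, min x z.1) := by fun_prop
      exact ((measurable_nearTopBound n).comp h1).add ((measurable_nearTopBound n).comp h2)
    have hstep := lintegral_pi_succ_last (unifOn (Set.Icc 0 (1 / φ)))
      (f := fun t r => nearTopBound n r (x - t) + nearTopBound n r (min x t)) hm
    simp only [nearTopBound]
    rw [hstep]
    have hne : ∀ᵐ t ∂unifOn (Set.Icc 0 (1 / φ)), t ≠ 0 ∧ t ≠ x := by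
      refine Measure.ae_smul_measure (ae_restrict_of_ae ?_) _
      filter_upwards [Measure.ae_ne volume (0 : ℝ), Measure.ae_ne volume x] with t h1 h2
      exact ⟨h1, h2⟩
    calc ENNReal.ofReal (1 + (n + 1 : ℕ) * φ * x)
        = ∫⁻ t, (ENNReal.ofReal (1 + n * φ * x) + (Set.Ioo 0 x).indicator 1 t)
            ∂unifOn (Set.Icc 0 (1 / φ)) := by
          rw [lintegral_add_left measurable_const, lintegral_indicator_one measurableSet_Ioo,
            unifOn_Icc_apply hφ le_rfl hx', lintegral_const, measure_univ, mul_one,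
            ← ENNReal.ofReal_add (by positivity) (by simp; positivity)]
          congr 1
          push_cast
          ring
      _ ≤ _ := by
          refine lintegral_mono_ae ?_
          filter_upwards [ae_unifOn_mem measurableSet_Icc, hne] with t ht htne
          rw [lintegral_add_left (hm1 _)]
          have ht0 : 0 < t := lt_of_le_of_ne ht.1 (Ne.symm htne.1)
          rcases lt_or_gt_of_ne htne.2 with h | h
          · rw [Set.indicator_of_mem (Set.mem_Ioo.2 ⟨ht0, h⟩), Pi.one_apply, min_eq_right h.le]
            refine le_trans ?_ (add_le_add (ih (sub_pos.2 h) (by linarith)) (ih ht0 ht.2))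
            have h1 : 0 ≤ x - t := by linarith
            rw [← ENNReal.ofReal_one, ← ENNReal.ofReal_add (by positivity) zero_le_one,
              ← ENNReal.ofReal_add (by positivity) (by positivity)]
            refine ENNReal.ofReal_le_ofReal (le_of_eq ?_)
            ring
          · rw [Set.indicator_of_notMem (fun h' => lt_asymm h h'.2), add_zero, min_eq_left h.le]
            exact (ih hx hx').trans le_add_self

lemma le_lintegral_paretoBound {φ : ℝ} (hφ : 0 < φ) (n : ℕ) :
    ENNReal.ofReal (1 + 3 / 8 * n + 1 / 8 * n ^ 2) ≤
      ∫⁻ r, paretoBound n r ∂Measure.pi (fun _ : Fin n => unifOn (Set.Icc 0 (1 / φ))) := by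
  have := isProbabilityMeasure_unifOn_Icc hφ
  induction n with
  | zero => simp [paretoBound]
  | succ n ih =>
    have hm : Measurable fun z : ℝ × (Fin n → ℝ) => nearTopBound n z.2 z.1 :=
      (measurable_nearTopBound n).comp measurable_swap
    have hstep := lintegral_pi_succ_last (unifOn (Set.Icc 0 (1 / φ)))
      (f := fun t r => paretoBound n r + nearTopBound n r t)
      (((measurable_paretoBound n).comp measurable_snd).add hm)
    simp only [paretoBound]
    rw [hstep]
    have hbound : ENNReal.ofReal ((1 + n / 2) * (1 / 2)) ≤
        ∫⁻ t, ∫⁻ r, nearTopBound n r t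
          ∂Measure.pi (fun _ : Fin n => unifOn (Set.Icc 0 (1 / φ)))
          ∂unifOn (Set.Icc 0 (1 / φ)) := by
      have hlen : φ * (1 / φ - 1 / (2 * φ)) = 1 / 2 := by
        field_simp
        norm_num
      calc ENNReal.ofReal ((1 + n / 2) * (1 / 2))
          = ∫⁻ t, (Set.Ioo (1 / (2 * φ)) (1 / φ)).indicator
              (fun _ => ENNReal.ofReal (1 + n / 2)) t ∂unifOn (Set.Icc 0 (1 / φ)) := by
            rw [lintegral_indicator_const measurableSet_Ioo,
              unifOn_Icc_apply hφ (by positivity) le_rfl, hlen,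
              ENNReal.ofReal_mul (by positivity)]
        _ ≤ _ := by
            refine lintegral_mono fun t => ?_
            rw [Set.indicator_apply]
            split_ifs with ht
            swap
            · exact bot_le
            have ht0 : 0 < t := lt_trans (by positivity) ht.1
            refine le_trans (ENNReal.ofReal_le_ofReal ?_)
              (le_lintegral_nearTopBound hφ n ht0 ht.2.le)
            have h1 : 1 / 2 ≤ φ * t := by
              have := (div_lt_iff₀ (by positivity)).1 ht.1
              linarith
            have := mul_le_mul_of_nonneg_left h1 (Nat.cast_nonneg (α := ℝ) n)
            linarith
    simp_rw [lintegral_add_left (measurable_paretoBound n)]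
    rw [lintegral_add_left measurable_const, lintegral_const, measure_univ, mul_one]
    refine le_trans ?_ (add_le_add ih hbound)
    rw [← ENNReal.ofReal_add (by positivity) (by positivity)]
    refine ENNReal.ofReal_le_ofReal (le_of_eq ?_)
    push_cast
    ring

/-- The solution selecting the single objects and the complete groups listed in `A`, where
group `i` is listed as `np + i`. -/
def solutionOfSubset {np nq : ℕ} (k : Fin nq → ℕ) (A : Finset ℕ) :
    Fin np ⊕ ((i : Fin nq) × Fin (k i)) → Bool :=
  Sum.elim (fun i => decide ((i : ℕ) ∈ A)) fun x => decide (np + (x.1 : ℕ) ∈ A)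

lemma totalVal_solutionOfSubset {np nq : ℕ} {k : Fin nq → ℕ}
    {u : Fin np ⊕ ((i : Fin nq) × Fin (k i)) → ℝ} {f : ℕ → ℝ}
    (h1 : ∀ i : Fin np, f i = u (Sum.inl i))
    (h2 : ∀ i : Fin nq, f (np + i) = ∑ l, u (Sum.inr ⟨i, l⟩))
    {A : Finset ℕ} (hA : A ⊆ range (np + nq)) :
    totalVal u (solutionOfSubset k A) = ∑ i ∈ A, f i := by
  have hsum : ∑ i ∈ A, f i = ∑ i ∈ range (np + nq), if i ∈ A then f i else 0 := by
    rw [← sum_filter, filter_mem_eq_inter, inter_eq_right.2 hA]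
  rw [hsum, sum_range_add, sum_range, sum_range, totalVal, Fintype.sum_sum_type,
    Fintype.sum_sigma]
  congr 1
  · refine sum_congr rfl fun i _ => ?_
    simp [solutionOfSubset, h1]
  · refine sum_congr rfl fun i _ => ?_
    by_cases h : np + (i : ℕ) ∈ A <;> simp [solutionOfSubset, h, h2]

lemma exists_solutionOfSubset_eq {np nq : ℕ} {k : Fin nq → ℕ}
    {s : Fin np ⊕ ((i : Fin nq) × Fin (k i)) → Bool}
    (hs : ∀ (i : Fin nq) (l l' : Fin (k i)), s (Sum.inr ⟨i, l⟩) = s (Sum.inr ⟨i, l'⟩)) :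
    ∃ A ⊆ range (np + nq), solutionOfSubset k A = s := by
  classical
  refine ⟨(range (np + nq)).filter fun j => (∃ i : Fin np, (i : ℕ) = j ∧ s (Sum.inl i)) ∨
    ∃ (i : Fin nq) (l : Fin (k i)), np + (i : ℕ) = j ∧ s (Sum.inr ⟨i, l⟩),
    filter_subset _ _, ?_⟩
  funext x
  rw [Bool.eq_iff_iff]
  rcases x with i | ⟨i, l⟩
  · simp only [solutionOfSubset, Sum.elim_inl, decide_eq_true_eq, mem_filter, mem_range]
    constructor
    · rintro ⟨-, ⟨i', hi', h⟩ | ⟨i', l, hi', h⟩⟩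
      · rwa [← Fin.ext hi']
      · omega
    · exact fun h => ⟨by omega, Or.inl ⟨i, rfl, h⟩⟩
  · simp only [solutionOfSubset, Sum.elim_inr, decide_eq_true_eq, mem_filter, mem_range]
    constructor
    · rintro ⟨-, ⟨i', hi', h⟩ | ⟨i', l', hi', h⟩⟩
      · omega
      · obtain rfl : i' = i := Fin.ext (by omega)
        rwa [hs i' l l']
    · exact fun h => ⟨by omega, Or.inr ⟨i, l, rfl, h⟩⟩

lemma solutionOfSubset_injOn {np nq : ℕ} {k : Fin nq → ℕ} (hk : ∀ i, 0 < k i) :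
    Set.InjOn (solutionOfSubset (np := np) k) {A | A ⊆ range (np + nq)} := by
  intro A hA B hB h
  have hmem : ∀ j < np + nq, (j ∈ A ↔ j ∈ B) := by
    intro j hj
    rcases lt_or_ge j np with hlt | hge
    · simpa [solutionOfSubset] using congrFun h (Sum.inl ⟨j, hlt⟩)
    · have := congrFun h (Sum.inr ⟨⟨j - np, by omega⟩, ⟨0, hk _⟩⟩)
      simpa [solutionOfSubset, Nat.add_sub_cancel' hge] using this
  ext j
  exact ⟨fun hj => (hmem j (mem_range.1 (hA hj))).1 hj,
    fun hj => (hmem j (mem_range.1 (hB hj))).2 hj⟩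

lemma card_paretoSubsets_le_ncard {np nq : ℕ} {k : Fin nq → ℕ} (hk : ∀ i, 0 < k i)
    {u v : Fin np ⊕ ((i : Fin nq) × Fin (k i)) → ℝ} {w r : ℕ → ℝ}
    (hw1 : ∀ i : Fin np, w i = u (Sum.inl i))
    (hw2 : ∀ i : Fin nq, w (np + i) = ∑ l, u (Sum.inr ⟨i, l⟩))
    (hr1 : ∀ i : Fin np, r i = v (Sum.inl i))
    (hr2 : ∀ i : Fin nq, r (np + i) = ∑ l, v (Sum.inr ⟨i, l⟩)) :
    #(paretoSubsets w r (np + nq)) ≤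
      (paretoSet {s | ∀ (i : Fin nq) (l l' : Fin (k i)),
        s (Sum.inr ⟨i, l⟩) = s (Sum.inr ⟨i, l'⟩)} u v).ncard := by
  rw [← Set.ncard_coe_finset]
  refine Set.ncard_le_ncard_of_injOn (solutionOfSubset k) (fun A hA => ?_)
    ((solutionOfSubset_injOn hk).mono fun A hA => (mem_paretoSubsets.1 hA).1) (Set.toFinite _)
  obtain ⟨hA, hdom⟩ := mem_paretoSubsets.1 (mem_coe.1 hA)
  refine ⟨fun i l l' => rfl, fun s hs => ?_⟩
  obtain ⟨B, hB, rfl⟩ := exists_solutionOfSubset_eq hs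
  simpa only [dominates, totalVal_solutionOfSubset hw1 hw2 hA,
    totalVal_solutionOfSubset hw1 hw2 hB, totalVal_solutionOfSubset hr1 hr2 hA,
    totalVal_solutionOfSubset hr1 hr2 hB] using hdom B hB

lemma sum_range_two_pow_succ_lt (n : ℕ) :
    ∑ i ∈ range n, (2 : ℝ) ^ (i + 1) < 2 ^ (n + 1) := by
  induction n with
  | zero => simp
  | succ n ih =>
    rw [sum_range_succ, pow_succ _ (n + 1)]
    linarith

lemma add_sum_geometric_eq {φ : ℝ} (hφ : 1 < φ) (np j : ℕ) :
    np / φ + ∑ i ∈ range j, (np + 1 : ℝ) / (φ - 1) * ((2 * φ - 1) / (φ - 1)) ^ i =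
      (np + 1 : ℝ) / (φ - 1) * ((2 * φ - 1) / (φ - 1)) ^ j -
        ((np + 1 : ℝ) / (φ - 1) * ((2 * φ - 1) / (φ - 1)) ^ j + 1) / φ := by
  have h1 : φ - 1 ≠ 0 := by linarith
  have h2 : φ ≠ 0 := by linarith
  induction j with
  | zero =>
    simp only [range_zero, sum_empty, pow_zero]
    field_simp
    ring
  | succ j ih =>
    rw [sum_range_succ, ← add_assoc, ih, pow_succ]
    field_simp
    ring

lemma pow_mul_card_paretoSubsets_le {w r : ℕ → ℝ} (hw0 : ∀ i, 0 ≤ w i)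
    (hw : ∀ n, ∑ i ∈ range n, w i < w n) {np nq : ℕ} (hr : ∀ i < np, 0 ≤ r i)
    (hlarge : ∀ j < nq, ∑ i ∈ range (np + j), r i < r (np + j)) :
    2 ^ nq * #(paretoSubsets w r np) ≤ #(paretoSubsets w r (np + nq)) := by
  suffices h : ∀ j ≤ nq, (∀ i < np + j, 0 ≤ r i) ∧
      2 ^ j * #(paretoSubsets w r np) ≤ #(paretoSubsets w r (np + j)) from (h nq le_rfl).2
  intro j
  induction j with
  | zero => exact fun _ => ⟨hr, by simp⟩
  | succ j ih =>
    intro hj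
    obtain ⟨h0, hcard⟩ := ih (by omega)
    have hl := hlarge j (by omega)
    refine ⟨fun i hi => ?_, ?_⟩
    · rcases Nat.lt_succ_iff_lt_or_eq.1 hi with h | rfl
      · exact h0 i h
      · exact (sum_nonneg fun i hi => h0 i (mem_range.1 hi)).trans hl.le
    · have := two_mul_card_paretoSubsets_le hw0 (hw (np + j)) h0 hl
      rw [pow_succ, ← add_assoc]
      linarith

lemma le_ncard_paretoSet {φ : ℝ} (hφ : 1 < φ) {np nq : ℕ} {m : Fin nq → ℝ}
    (hm : ∀ i : Fin nq,
      m i = ((np + 1 : ℝ) / (φ - 1)) * ((2 * φ - 1) / (φ - 1)) ^ (i : ℕ))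
    {k : Fin nq → ℕ} (hk0 : ∀ i, 0 < k i) (hk : ∀ i, (k i : ℝ) < m i + 1)
    {P : Fin np ⊕ ((i : Fin nq) × Fin (k i)) → ℝ}
    (hP1 : ∀ i : Fin np, P (Sum.inl i) ∈ Set.Icc 0 (1 / φ))
    (hP2 : ∀ (i : Fin nq) (l : Fin (k i)),
      P (Sum.inr ⟨i, l⟩) ∈ Set.Ioc (m i / (k i : ℝ) - 1 / φ) (m i / (k i : ℝ))) :
    2 ^ nq * paretoBound np (fun i => P (Sum.inl i)) ≤
      ((paretoSet
            {s : (Fin np ⊕ ((i : Fin nq) × Fin (k i))) → Bool |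
              ∀ (i : Fin nq) (l l' : Fin (k i)),
                s (Sum.inr ⟨i, l⟩) = s (Sum.inr ⟨i, l'⟩)}
            (Sum.elim (fun i : Fin np => (2 : ℝ) ^ ((i : ℕ) + 1))
              (fun x : (i : Fin nq) × Fin (k i) =>
                (2 : ℝ) ^ (np + (x.1 : ℕ) + 1) / (k x.1)))
            P).ncard : ENNReal) := by
  have hφ0 : 0 < φ := by linarith
  let w : ℕ → ℝ := fun i => 2 ^ (i + 1)
  let r : ℕ → ℝ := fun j =>
    if h : j < np then P (Sum.inl ⟨j, h⟩)
    else if h' : j - np < nq then ∑ l, P (Sum.inr ⟨⟨j - np, h'⟩, l⟩) else 0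
  have hw0 : ∀ i, 0 ≤ w i := fun i => by positivity
  have hr1 : ∀ i : Fin np, r i = P (Sum.inl i) := fun i => by simp [r]
  have hr2 : ∀ i : Fin nq, r (np + i) = ∑ l, P (Sum.inr ⟨i, l⟩) := fun i => by
    have h : np + (i : ℕ) - np = i := by omega
    simp only [r]
    rw [dif_neg (by omega), dif_pos (by omega)]
    have hi : (⟨np + (i : ℕ) - np, by omega⟩ : Fin nq) = i := Fin.ext h
    rw [hi]
  have hkpos : ∀ i, (0 : ℝ) < k i := fun i => Nat.cast_pos.2 (hk0 i)
  have hle : ∀ i : Fin nq, r (np + i) ≤ m i := fun i => by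
    rw [hr2]
    calc ∑ l, P (Sum.inr ⟨i, l⟩) ≤ ∑ _l : Fin (k i), m i / k i :=
          sum_le_sum fun l _ => (hP2 i l).2
      _ = m i := by
          have := (hkpos i).ne'
          simp
          field_simp
  have hlt : ∀ i : Fin nq, m i - (m i + 1) / φ < r (np + i) := fun i => by
    rw [hr2]
    calc m i - (m i + 1) / φ < m i - k i / φ := by
          have := div_lt_div_of_pos_right (hk i) hφ0
          linarith
      _ = ∑ _l : Fin (k i), (m i / k i - 1 / φ) := by
          have := (hkpos i).ne'
          simp
          field_simp
      _ ≤ _ := sum_le_sum fun l _ => (hP2 i l).1.le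
  have hr : ∀ i < np, 0 ≤ r i := fun i hi => by
    rw [hr1 ⟨i, hi⟩]
    exact (hP1 _).1
  have hlarge : ∀ j < nq, ∑ i ∈ range (np + j), r i < r (np + j) := fun j hj => by
    have hsingle : ∑ i ∈ range np, r i ≤ np / φ := by
      calc ∑ i ∈ range np, r i ≤ ∑ _i ∈ range np, 1 / φ := by
            refine sum_le_sum fun i hi => ?_
            rw [hr1 ⟨i, mem_range.1 hi⟩]
            exact (hP1 _).2
        _ = np / φ := by simp [div_eq_mul_inv]
    have hgroup : ∑ i ∈ range j, r (np + i) ≤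
        ∑ i ∈ range j, (np + 1 : ℝ) / (φ - 1) * ((2 * φ - 1) / (φ - 1)) ^ i := by
      refine sum_le_sum fun i hi => ?_
      have h := hle ⟨i, (mem_range.1 hi).trans hj⟩
      rwa [hm] at h
    have h := hlt ⟨j, hj⟩
    rw [hm, ← add_sum_geometric_eq hφ] at h
    rw [sum_range_add]
    linarith
  have hcard := (pow_mul_card_paretoSubsets_le hw0 sum_range_two_pow_succ_lt hr hlarge).trans
    (card_paretoSubsets_le_ncard (v := P) hk0
      (u := Sum.elim (fun i : Fin np => (2 : ℝ) ^ ((i : ℕ) + 1))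
        (fun x : (i : Fin nq) × Fin (k i) => (2 : ℝ) ^ (np + (x.1 : ℕ) + 1) / (k x.1)))
      (fun i => rfl) (fun i => by
        have := (hkpos i).ne'
        simp [w]
        field_simp) hr1 hr2)
  calc 2 ^ nq * paretoBound np (fun i => P (Sum.inl i))
      ≤ 2 ^ nq * (#(paretoSubsets w r np) : ENNReal) := by
        simp_rw [← hr1]
        gcongr
        exact paretoBound_le hw0 sum_range_two_pow_succ_lt np hr
    _ ≤ _ := by exact_mod_cast hcard

lemma measurePreserving_pi_inl {ι ι' : Type*} [Fintype ι] [Fintype ι'] (μ : ι ⊕ ι' → Measure ℝ)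
    [∀ x, IsProbabilityMeasure (μ x)] :
    MeasurePreserving (fun (P : ι ⊕ ι' → ℝ) (i : ι) => P (Sum.inl i)) (Measure.pi μ)
      (Measure.pi fun i => μ (Sum.inl i)) :=
  measurePreserving_fst.comp (measurePreserving_sumPiEquivProdPi μ)

/-- Splitting each object `b_i` into `k_i = ⌈m_i⌉` grouped objects
`b_i^(l)` of weight `2^{n_p+i}/k_i` and profit uniform in `(m_i/k_i - 1/φ, m_i/k_i]`,
with the solution set forcing each group to be taken completely or not at all, the
expected number of Pareto optimal solutions is at least `c · n_p² · 2^{n_q}`. -/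
theorem expected_pareto_lower_bound_split : ∃ c : ℝ, 0 < c ∧
    ∀ (φ : ℝ), 1 < φ → ∀ (np nq : ℕ), 0 < np → 0 < nq →
    ∀ m : Fin nq → ℝ,
      (∀ i : Fin nq,
        m i = ((np + 1 : ℝ) / (φ - 1)) * ((2 * φ - 1) / (φ - 1)) ^ (i : ℕ)) →
    ∀ k : Fin nq → ℕ, (∀ i, (k i : ℤ) = ⌈m i⌉) →
    ENNReal.ofReal (c * np ^ 2 * 2 ^ nq) ≤
      ∫⁻ P : (Fin np ⊕ ((i : Fin nq) × Fin (k i))) → ℝ,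
        ((paretoSet
            {s : (Fin np ⊕ ((i : Fin nq) × Fin (k i))) → Bool |
              ∀ (i : Fin nq) (l l' : Fin (k i)),
                s (Sum.inr ⟨i, l⟩) = s (Sum.inr ⟨i, l'⟩)}
            (Sum.elim (fun i : Fin np => (2 : ℝ) ^ ((i : ℕ) + 1))
              (fun x : (i : Fin nq) × Fin (k i) =>
                (2 : ℝ) ^ (np + (x.1 : ℕ) + 1) / (k x.1)))
            P).ncard : ENNReal)
        ∂(Measure.pi fun x : Fin np ⊕ ((i : Fin nq) × Fin (k i)) =>
            match x with
            | Sum.inl _ => unifOn (Set.Icc 0 (1 / φ))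
            | Sum.inr ⟨i, _⟩ =>
                unifOn (Set.Ioc (m i / (k i : ℝ) - 1 / φ) (m i / (k i : ℝ)))) := by
  refine ⟨1 / 8, by norm_num, fun φ hφ np nq _ _ m hm k hk => ?_⟩
  have hφ0 : 0 < φ := by linarith
  have hmpos : ∀ i, 0 < m i := fun i => by
    rw [hm]
    have h1 : 0 < φ - 1 := by linarith
    have h2 : 0 < 2 * φ - 1 := by linarith
    positivity
  have hk0 : ∀ i, 0 < k i := fun i => by
    have h := Int.ceil_pos.2 (hmpos i)
    rw [← hk] at h
    exact_mod_cast h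
  have hk1 : ∀ i, (k i : ℝ) < m i + 1 := fun i => by
    have h := Int.ceil_lt_add_one (m i)
    rw [← hk] at h
    exact_mod_cast h
  set μ : Fin np ⊕ ((i : Fin nq) × Fin (k i)) → Measure ℝ := fun x =>
    match x with
    | Sum.inl _ => unifOn (Set.Icc 0 (1 / φ))
    | Sum.inr ⟨i, _⟩ => unifOn (Set.Ioc (m i / (k i : ℝ) - 1 / φ) (m i / (k i : ℝ))) with hμ
  have hprob : ∀ x, IsProbabilityMeasure (μ x) := by
    rintro (i | ⟨i, l⟩)
    · exact isProbabilityMeasure_unifOn_Icc hφ0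
    · refine isProbabilityMeasure_unifOn ?_ ?_ <;> simp [hφ0]
  have hae : ∀ (x) (s : Set ℝ), (∀ᵐ t ∂μ x, t ∈ s) → ∀ᵐ P ∂Measure.pi μ, P x ∈ s :=
    fun x s h => (measurePreserving_eval μ x).quasiMeasurePreserving.ae h
  have hP1 : ∀ᵐ P ∂Measure.pi μ, ∀ i : Fin np, P (Sum.inl i) ∈ Set.Icc 0 (1 / φ) :=
    ae_all_iff.2 fun i => hae _ _ (ae_unifOn_mem measurableSet_Icc)
  have hP2 : ∀ᵐ P ∂Measure.pi μ, ∀ (i : Fin nq) (l : Fin (k i)),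
      P (Sum.inr ⟨i, l⟩) ∈ Set.Ioc (m i / (k i : ℝ) - 1 / φ) (m i / (k i : ℝ)) :=
    ae_all_iff.2 fun i => ae_all_iff.2 fun l => hae _ _ (ae_unifOn_mem measurableSet_Ioc)
  have hproj : MeasurePreserving
      (fun (P : Fin np ⊕ ((i : Fin nq) × Fin (k i)) → ℝ) (i : Fin np) => P (Sum.inl i))
      (Measure.pi μ) (Measure.pi fun _ : Fin np => unifOn (Set.Icc 0 (1 / φ))) :=
    measurePreserving_pi_inl μ
  calc ENNReal.ofReal (1 / 8 * np ^ 2 * 2 ^ nq)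
      ≤ 2 ^ nq * ENNReal.ofReal (1 + 3 / 8 * np + 1 / 8 * np ^ 2) := by
        rw [mul_comm, ENNReal.ofReal_mul (by positivity), ENNReal.ofReal_pow (by norm_num),
          ENNReal.ofReal_ofNat]
        gcongr
        have : (0 : ℝ) ≤ np := np.cast_nonneg
        linarith
    _ ≤ 2 ^ nq * ∫⁻ r, paretoBound np r
          ∂Measure.pi (fun _ : Fin np => unifOn (Set.Icc 0 (1 / φ))) := by
        gcongr
        exact le_lintegral_paretoBound hφ0 np
    _ = ∫⁻ P, 2 ^ nq * paretoBound np (fun i => P (Sum.inl i)) ∂Measure.pi μ := by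
        have hmeas : Measurable fun P : Fin np ⊕ ((i : Fin nq) × Fin (k i)) → ℝ =>
            paretoBound np (fun i => P (Sum.inl i)) :=
          (measurable_paretoBound np).comp hproj.measurable
        rw [lintegral_const_mul _ hmeas, hproj.lintegral_comp (measurable_paretoBound np)]
    _ ≤ _ := by
        refine lintegral_mono_ae ?_
        filter_upwards [hP1, hP2] with P h1 h2
        exact le_ncard_paretoSet hφ hm hk0 hk1 h1 h2
end

section
/- There exist constants c, α, β > 0 such that for every integer n ≥ 4 and every real φ ≥ (3+√5)/2 there exist an integer N ≤ n, a solution set S ⊆ {0,1}^N, weights w_1,...,w_N ∈ ℝ, and for each i an interval I_i ⊆ [0,1] of length 1/φ such that, when the profits p_1,...,p_N are drawn independently and uniformly from I_1,...,I_N (so each profit density is bounded by φ), the expected number of Pareto optimal solutions of the bi-criteria problem K_S (minimize Σ w_i s_i, maximize Σ p_i s_i over s ∈ S) is at least c · min( n² · φ^{1 − α/φ}, 2^{β n} ). -/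
open MeasureTheory Finset

/-- The sum of the `r i`, `i < k`, over the indices not belonging to `t`. -/
noncomputable def deficit (r : ℕ → ℝ) (k : ℕ) (t : Finset ℕ) : ℝ :=
  ∑ i ∈ range k, if i ∈ t then 0 else r i

/-- Every element of `t` outweighs all smaller indices missing from `t`. -/
def IsGood (r : ℕ → ℝ) (t : Finset ℕ) : Prop :=
  ∀ j ∈ t, deficit r j t < r j

open Classical in
/-- The good subsets of `range k` whose deficit is less than `x`. -/
noncomputable def goodSets (r : ℕ → ℝ) (k : ℕ) (x : ℝ) : Finset (Finset ℕ) :=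
  {t ∈ (range k).powerset | IsGood r t ∧ deficit r k t < x}

lemma deficit_congr {r : ℕ → ℝ} {k : ℕ} {t t' : Finset ℕ}
    (h : ∀ i < k, i ∈ t ↔ i ∈ t') : deficit r k t = deficit r k t' :=
  Finset.sum_congr rfl fun i hi => by simp [h i (mem_range.1 hi)]

lemma deficit_congr_left {r r' : ℕ → ℝ} {k : ℕ} (h : ∀ i < k, r i = r' i) (t : Finset ℕ) :
    deficit r k t = deficit r' k t :=
  Finset.sum_congr rfl fun i hi => by simp [h i (mem_range.1 hi)]

lemma deficit_insert_of_le {r : ℕ → ℝ} {j k : ℕ} (hjk : j ≤ k) (t : Finset ℕ) :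
    deficit r j (insert k t) = deficit r j t :=
  deficit_congr fun i hi => by
    have : i ≠ k := by omega
    simp [this]

lemma goodSets_congr {r r' : ℕ → ℝ} {k : ℕ} (h : ∀ i < k, r i = r' i) (x : ℝ) :
    goodSets r k x = goodSets r' k x := by
  classical
  unfold goodSets
  refine Finset.filter_congr fun t ht => ?_
  rw [mem_powerset] at ht
  have hg : IsGood r t ↔ IsGood r' t := forall₂_congr fun j hj => by
    have hjk : j < k := mem_range.1 (ht hj)
    rw [deficit_congr_left fun i hi => h i (hi.trans hjk), h j hjk]
  rw [hg, deficit_congr_left h]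

lemma card_goodSets_zero (r : ℕ → ℝ) {x : ℝ} :
    (goodSets r 0 x).card = if 0 < x then 1 else 0 := by
  by_cases hx : 0 < x <;> simp [goodSets, deficit, IsGood, hx, Finset.filter_singleton]

/-- Good subsets of `range (k + 1)` split according to whether they contain `k`. -/
lemma card_goodSets_succ (r : ℕ → ℝ) (k : ℕ) (x : ℝ) :
    (goodSets r (k + 1) x).card =
      (goodSets r k (x - r k)).card + (goodSets r k (min x (r k))).card := by
  classical
  unfold goodSets
  simp only [Finset.card_filter]
  rw [Finset.range_add_one, Finset.sum_powerset_insert (by simp)]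
  congr 1 <;> refine Finset.sum_congr rfl fun t ht => ?_
  · have hk : k ∉ t := fun h => by simpa using mem_powerset.1 ht h
    simp [deficit, Finset.sum_range_succ, hk, lt_sub_iff_add_lt]
  · have ht' : ∀ j ∈ t, j < k := fun j h => by simpa using mem_powerset.1 ht h
    have hg : IsGood r (insert k t) ↔ IsGood r t ∧ deficit r k t < r k := by
      simp only [IsGood, mem_insert, forall_eq_or_imp, deficit_insert_of_le le_rfl]
      rw [and_comm]
      refine and_congr_left fun _ => forall₂_congr fun j hj => ?_
      rw [deficit_insert_of_le (ht' j hj).le]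
    have hd : deficit r (k + 1) (insert k t) = deficit r k t := by
      rw [← deficit_insert_of_le (r := r) le_rfl t, deficit, Finset.sum_range_succ,
        if_pos (mem_insert_self k t), add_zero, deficit]
    simp only [hg, hd, lt_min_iff, and_assoc, and_comm (a := deficit r k t < r k)]

/-- The value of the subset `t` of `range k`. -/
noncomputable def rangeVal (r : ℕ → ℝ) (k : ℕ) (t : Finset ℕ) : ℝ :=
  ∑ i ∈ range k, if i ∈ t then r i else 0

lemma rangeVal_add_deficit (r : ℕ → ℝ) (k : ℕ) (t : Finset ℕ) :
    rangeVal r k t + deficit r k t = ∑ i ∈ range k, r i := by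
  rw [rangeVal, deficit, ← Finset.sum_add_distrib]
  exact Finset.sum_congr rfl fun i _ => by split_ifs <;> simp

lemma rangeVal_nonneg {r : ℕ → ℝ} {k : ℕ} (hr : ∀ i < k, 0 ≤ r i) (t : Finset ℕ) :
    0 ≤ rangeVal r k t :=
  Finset.sum_nonneg fun i hi => by
    have := hr i (mem_range.1 hi)
    split_ifs <;> simp [this]

lemma rangeVal_le_sum {r : ℕ → ℝ} {k : ℕ} (hr : ∀ i < k, 0 ≤ r i) (t : Finset ℕ) :
    rangeVal r k t ≤ ∑ i ∈ range k, r i :=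
  Finset.sum_le_sum fun i hi => by
    have := hr i (mem_range.1 hi)
    split_ifs <;> simp [this]

lemma rangeVal_two_pow_lt (k : ℕ) (t : Finset ℕ) :
    rangeVal (fun i => 2 ^ i) k t < 2 ^ k := by
  refine (rangeVal_le_sum (fun i _ => by positivity) t).trans_lt ?_
  have h := mul_geom_sum (2 : ℝ) k
  linarith

/-- For the weights `2 ^ i`, a good set is Pareto optimal, and it is the unique solution
with its weight and profit. -/
lemma IsGood.mem_iff_of_le {r : ℕ → ℝ} {t t' : Finset ℕ} (ht : IsGood r t) :
    ∀ {k : ℕ}, (∀ i < k, 0 ≤ r i) →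
      rangeVal (fun i => 2 ^ i) k t' ≤ rangeVal (fun i => 2 ^ i) k t →
      rangeVal r k t ≤ rangeVal r k t' → ∀ i < k, i ∈ t' ↔ i ∈ t
  | 0, _, _, _, i, hi => absurd hi (by simp)
  | k + 1, hr, hw, hp, i, hi => by
    have hr' : ∀ i < k, 0 ≤ r i := fun i hi => hr i (by omega)
    have ih := ht.mem_iff_of_le (t' := t') hr'
    have hsucc : ∀ (q : ℕ → ℝ) (s : Finset ℕ),
        rangeVal q (k + 1) s = rangeVal q k s + if k ∈ s then q k else 0 := fun q s =>
      Finset.sum_range_succ _ _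
    rw [hsucc, hsucc] at hw hp
    by_cases h : k ∈ t <;> by_cases h' : k ∈ t'
    · simp only [h, h', if_true, add_le_add_iff_right] at hw hp
      rcases Nat.lt_succ_iff_lt_or_eq.1 hi with hi | rfl
      · exact ih hw hp i hi
      · simp [h, h']
    · simp only [h, h', if_true, if_false, add_zero] at hp
      have h1 := ht k h
      have h2 := rangeVal_add_deficit r k t
      have h3 := rangeVal_le_sum hr' t'
      linarith
    · simp only [h, h', if_true, if_false, add_zero] at hw
      have h1 := rangeVal_two_pow_lt k t
      have h2 := rangeVal_nonneg (r := fun i => 2 ^ i) (k := k) (fun i _ => by positivity) t'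
      linarith
    · simp only [h, h', if_false, add_zero] at hw hp
      rcases Nat.lt_succ_iff_lt_or_eq.1 hi with hi | rfl
      · exact ih hw hp i hi
      · simp [h, h']

/-- Extension by zero of a vector to a sequence. -/
noncomputable def extendZero {n : ℕ} (p : Fin n → ℝ) (i : ℕ) : ℝ :=
  if h : i < n then p ⟨i, h⟩ else 0

lemma extendZero_val {n : ℕ} (p : Fin n → ℝ) (i : Fin n) : extendZero p i = p i := by
  simp [extendZero]

lemma totalVal_eq {u k : ℕ} (p : Fin (u + k) → ℝ) (s : Fin (u + k) → Bool) :
    totalVal p s =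
      rangeVal (extendZero p) u {i ∈ range u | ∃ h : i < u + k, s ⟨i, h⟩ = true} +
      rangeVal (fun i => extendZero p (u + i)) k
        {i ∈ range k | ∃ h : u + i < u + k, s ⟨u + i, h⟩ = true} := by
  rw [totalVal, Fin.sum_univ_add, rangeVal, rangeVal, ← Fin.sum_univ_eq_sum_range,
    ← Fin.sum_univ_eq_sum_range]
  congr 1 <;> refine Finset.sum_congr rfl fun i _ => ?_
  · have h1 : (i : ℕ) < u + k := by omega
    have h2 : Fin.castAdd k i = ⟨i, h1⟩ := rfl
    simp [extendZero, h1, h2]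
  · have h1 : u + (i : ℕ) < u + k := by omega
    have h2 : Fin.natAdd u i = ⟨u + i, h1⟩ := rfl
    simp [extendZero, h2]

/-- The solutions consisting of a prefix of length `j * g`, `j ≤ J`, of the first `u` objects
and of an arbitrary set of further objects. -/
def prefixSolutions (u k g J : ℕ) : Set (Fin (u + k) → Bool) :=
  {s | ∃ j ≤ J, ∀ i : Fin (u + k), i.val < u → (s i = true ↔ i.val < j * g)}

/-- Weights `2 ^ k` for the first `u` objects and `1, 2, 4, …` for the others. -/
noncomputable def binaryWeights (u k : ℕ) (i : Fin (u + k)) : ℝ :=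
  if i.val < u then 2 ^ k else 2 ^ (i.val - u)

/-- The objects after the first `u` chosen by `s`. -/
noncomputable def tailSet {u k : ℕ} (s : Fin (u + k) → Bool) : Finset ℕ :=
  {i ∈ range k | ∃ h : u + i < u + k, s ⟨u + i, h⟩ = true}

/-- The solution made of a prefix of length `a` of the first `u` objects and the set `t` of
further objects. -/
def prefixSolution (u k a : ℕ) (t : Finset ℕ) (i : Fin (u + k)) : Bool :=
  if i.val < u then decide (i.val < a) else decide (i.val - u ∈ t)

lemma rangeVal_congr {r r' : ℕ → ℝ} {k : ℕ} (h : ∀ i < k, r i = r' i) (t : Finset ℕ) :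
    rangeVal r k t = rangeVal r' k t :=
  Finset.sum_congr rfl fun i hi => by simp [h i (mem_range.1 hi)]

lemma tailSet_prefixSolution {u k : ℕ} (a : ℕ) {t : Finset ℕ} (ht : t ⊆ range k) :
    tailSet (prefixSolution u k a t) = t := by
  ext i
  have h : i ∈ t → i < k := fun h => mem_range.1 (ht h)
  simp only [tailSet, prefixSolution, mem_filter, mem_range]
  simp
  exact fun hi => h hi

lemma totalVal_of_prefix {u k a : ℕ} (ha : a ≤ u) (p : Fin (u + k) → ℝ) {s : Fin (u + k) → Bool}
    (hs : ∀ i : Fin (u + k), i.val < u → (s i = true ↔ i.val < a)) :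
    totalVal p s = ∑ i ∈ range a, extendZero p i +
      rangeVal (fun i => extendZero p (u + i)) k (tailSet s) := by
  rw [totalVal_eq, tailSet]
  congr 1
  rw [rangeVal, ← Finset.sum_filter]
  refine Finset.sum_congr ?_ fun _ _ => rfl
  ext i
  simp only [mem_filter, mem_range]
  constructor
  · rintro ⟨hi, -, h, hsi⟩
    exact (hs ⟨i, h⟩ hi).1 hsi
  · intro hi
    have hiu : i < u := hi.trans_le ha
    have h : i < u + k := by omega
    exact ⟨hiu, hiu, h, (hs ⟨i, h⟩ hiu).2 hi⟩

lemma totalVal_binaryWeights_of_prefix {u k a : ℕ} (ha : a ≤ u) {s : Fin (u + k) → Bool}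
    (hs : ∀ i : Fin (u + k), i.val < u → (s i = true ↔ i.val < a)) :
    totalVal (binaryWeights u k) s = a * 2 ^ k + rangeVal (fun i => 2 ^ i) k (tailSet s) := by
  rw [totalVal_of_prefix ha _ hs]
  congr 1
  · rw [Finset.sum_congr rfl (g := fun _ => (2 : ℝ) ^ k)]
    · simp
    · intro i hi
      have h1 : i < u := (mem_range.1 hi).trans_le ha
      have h2 : i < u + k := by omega
      simp [extendZero, binaryWeights, h1, h2]
  · refine rangeVal_congr (fun i hi => ?_) _
    simp [extendZero, binaryWeights, hi]

lemma card_mul_le_ncard_paretoSet {u k g J : ℕ} (hg : 1 ≤ g) (hJ : J * g ≤ u) {L x : ℝ}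
    (hL : 0 ≤ L) (hx : x ≤ g * L) (p : Fin (u + k) → ℝ) (hu : ∀ i < u, L ≤ extendZero p i)
    (hk : ∀ i < k, 0 ≤ extendZero p (u + i)) :
    (J + 1) * (goodSets (fun i => extendZero p (u + i)) k x).card ≤
      (paretoSet (prefixSolutions u k g J) (binaryWeights u k) p).ncard := by
  classical
  set r : ℕ → ℝ := fun i => extendZero p (u + i) with hr
  set A := range (J + 1) ×ˢ goodSets r k x with hA
  have hpre : ∀ (a : ℕ) t (i : Fin (u + k)), i.val < u →
      (prefixSolution u k a t i = true ↔ i.val < a) := fun a t i hi => by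
    simp [prefixSolution, hi]
  have hbound : ∀ {j}, j ≤ J → j * g ≤ u := fun h => (Nat.mul_le_mul_right g h).trans hJ
  have hinj : Set.InjOn (fun q : ℕ × Finset ℕ => prefixSolution u k (q.1 * g) q.2) A := by
    rintro ⟨j, t⟩ h ⟨j', t'⟩ h' heq
    simp only [hA, coe_product, Set.mem_prod, mem_coe, mem_range, goodSets, mem_filter,
      mem_powerset, Nat.lt_succ_iff] at h h'
    have ht := congrArg tailSet heq
    simp only [tailSet_prefixSolution _ h.2.1, tailSet_prefixSolution _ h'.2.1] at ht
    have hw := congrArg (totalVal (binaryWeights u k)) heq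
    simp only [totalVal_binaryWeights_of_prefix (hbound h.1) (hpre _ _),
      totalVal_binaryWeights_of_prefix (hbound h'.1) (hpre _ _),
      tailSet_prefixSolution _ h'.2.1, ht, add_left_inj] at hw
    have hj : j * g = j' * g := by
      have := mul_right_cancel₀ (by positivity) hw
      exact_mod_cast this
    rw [Prod.mk.injEq]
    exact ⟨Nat.eq_of_mul_eq_mul_right (by omega) hj, ht⟩
  have hcard : (J + 1) * (goodSets r k x).card = A.card := by simp [hA]
  rw [hcard, ← Set.ncard_coe_finset, ← hinj.ncard_image]
  refine Set.ncard_le_ncard ?_ (Set.toFinite _)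
  rintro _ ⟨⟨j, t⟩, h, rfl⟩
  simp only [hA, coe_product, Set.mem_prod, mem_coe, mem_range, goodSets, mem_filter,
    mem_powerset, Nat.lt_succ_iff] at h
  obtain ⟨hj, htk, htg, htx⟩ := h
  refine ⟨⟨j, hj, hpre _ _⟩, ?_⟩
  rintro s ⟨j', hj', hs⟩ ⟨hw, hp, hlt⟩
  rw [totalVal_binaryWeights_of_prefix (hbound hj) (hpre _ _),
    totalVal_binaryWeights_of_prefix (hbound hj') hs, tailSet_prefixSolution _ htk] at hw hlt
  rw [totalVal_of_prefix (hbound hj) _ (hpre _ _),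
    totalVal_of_prefix (hbound hj') _ hs, tailSet_prefixSolution _ htk] at hp hlt
  rcases lt_trichotomy j' j with hlt' | rfl | hlt'
  · have hle : j' * g + g ≤ j * g := by nlinarith
    have hstep : ∑ i ∈ range (j' * g), extendZero p i + g * L ≤
        ∑ i ∈ range (j * g), extendZero p i := by
      rw [← Finset.sum_range_add_sum_Ico _ (by omega : j' * g ≤ j * g)]
      gcongr
      calc (g : ℝ) * L ≤ (j * g - j' * g : ℕ) * L := by
            gcongr
            omega
        _ = ∑ i ∈ Ico (j' * g) (j * g), L := by simp
        _ ≤ _ := Finset.sum_le_sum fun i hi =>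
            hu i ((mem_Ico.1 hi).2.trans_le (hbound hj))
    have h1 := rangeVal_le_sum hk (tailSet s)
    have h2 := rangeVal_add_deficit r k t
    linarith
  · simp only [add_le_add_iff_left, add_lt_add_iff_left] at hw hp hlt
    have hiff := htg.mem_iff_of_le hk hw hp
    have heq : tailSet s = t := by
      ext i
      by_cases hi : i < k
      · exact hiff i hi
      · have h1 : i ∉ tailSet s := fun h => hi (mem_range.1 (mem_filter.1 h).1)
        have h2 : i ∉ t := fun h => hi (mem_range.1 (htk h))
        simp [h1, h2]
    simp [heq] at hlt
  · have hle : j * g + 1 ≤ j' * g := by nlinarith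
    have hle' : ((j * g : ℕ) : ℝ) + 1 ≤ (j' * g : ℕ) := by exact_mod_cast hle
    have h1 := rangeVal_two_pow_lt k t
    have h2 := rangeVal_nonneg (r := fun i => 2 ^ i) (k := k) (fun i _ => by positivity)
      (tailSet s)
    have h3 : (0 : ℝ) < 2 ^ k := by positivity
    nlinarith

lemma measurable_extendZero {n : ℕ} (i : ℕ) :
    Measurable fun p : Fin n → ℝ => extendZero p i := by
  unfold extendZero
  split_ifs <;> fun_prop

lemma measurable_card_goodSets (u n : ℕ) (k : ℕ) :
    Measurable fun q : (Fin n → ℝ) × ℝ =>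
      ((goodSets (fun i => extendZero q.1 (u + i)) k q.2).card : ENNReal) := by
  induction k with
  | zero =>
    simp only [card_goodSets_zero, Nat.cast_ite]
    exact Measurable.ite (measurableSet_lt measurable_const measurable_snd)
      measurable_const measurable_const
  | succ k ih =>
    obtain ⟨G, hG⟩ : ∃ G : (Fin n → ℝ) × ℝ → ENNReal, ∀ q, ((goodSets
        (fun i => extendZero q.1 (u + i)) k q.2).card : ENNReal) = G q := ⟨_, fun _ => rfl⟩
    have hG' : ∀ p z, ((goodSets (fun i => extendZero p (u + i)) k z).card : ENNReal) =
        G (p, z) := fun p z => hG (p, z)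
    simp only [card_goodSets_succ, Nat.cast_add, hG'] at ih ⊢
    have h : Measurable fun q : (Fin n → ℝ) × ℝ => extendZero q.1 (u + k) :=
      (measurable_extendZero _).comp measurable_fst
    exact (ih.comp (measurable_fst.prodMk (measurable_snd.sub h))).add
      (ih.comp (measurable_fst.prodMk (measurable_snd.min h)))

/-- The expected number of good sets of deficit less than `x`, if the objects `u + i`, `i < k`,
have independent random values distributed according to `ν`. -/
noncomputable def expectedGood (ν : ℕ → Measure ℝ) (u k : ℕ) (x : ℝ) : ENNReal :=
  ∫⁻ p : Fin (u + k) → ℝ, ((goodSets (fun i => extendZero p (u + i)) k x).card : ENNReal)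
    ∂(Measure.pi fun i : Fin (u + k) => ν i)

lemma expectedGood_zero (ν : ℕ → Measure ℝ) [∀ i, IsProbabilityMeasure (ν i)] (u : ℕ) {x : ℝ}
    (hx : 0 < x) : expectedGood ν u 0 x = 1 := by
  simp [expectedGood, card_goodSets_zero, hx]

lemma expectedGood_succ (ν : ℕ → Measure ℝ) [∀ i, IsProbabilityMeasure (ν i)] (u k : ℕ) (x : ℝ) :
    expectedGood ν u (k + 1) x =
      ∫⁻ y, (expectedGood ν u k (x - y) + expectedGood ν u k (min x y)) ∂ν (u + k) := by
  have hmp := measurePreserving_piFinSuccAbove (n := u + k)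
    (fun i : Fin (u + k + 1) => ν i) (Fin.last (u + k))
  simp only [Fin.succAbove_last, Fin.val_last, Fin.val_castSucc] at hmp
  obtain ⟨G, hG⟩ : ∃ G : (Fin (u + k) → ℝ) × ℝ → ENNReal, ∀ q, G q =
      ((goodSets (fun i => extendZero q.1 (u + i)) k q.2).card : ENNReal) := ⟨_, fun _ => rfl⟩
  have hGm : Measurable G := by
    rw [funext hG]
    exact measurable_card_goodSets u (u + k) k
  have hexp : ∀ z, expectedGood ν u k z =
      ∫⁻ p, G (p, z) ∂(Measure.pi fun i : Fin (u + k) => ν i) := fun z => by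
    simp only [hG, expectedGood]
  have h1 : Measurable fun q : ℝ × (Fin (u + k) → ℝ) => G (q.2, x - q.1) :=
    hGm.comp (measurable_snd.prodMk (measurable_const.sub measurable_fst))
  have h2 : Measurable fun q : ℝ × (Fin (u + k) → ℝ) => G (q.2, min x q.1) :=
    hGm.comp (measurable_snd.prodMk (measurable_const.min measurable_fst))
  have h12 : Measurable fun q : ℝ × (Fin (u + k) → ℝ) =>
      G (q.2, x - q.1) + G (q.2, min x q.1) := h1.add h2
  calc expectedGood ν u (k + 1) x
      = ∫⁻ p : Fin (u + k + 1) → ℝ, (G (fun i => p i.castSucc, x - p (Fin.last _)) +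
          G (fun i => p i.castSucc, min x (p (Fin.last _))))
          ∂(Measure.pi fun i : Fin (u + k + 1) => ν i) := by
        refine lintegral_congr fun p => ?_
        rw [card_goodSets_succ, Nat.cast_add, hG, hG]
        have hlast : extendZero p (u + k) = p (Fin.last _) := extendZero_val p (Fin.last (u + k))
        have hcong : ∀ i < k, extendZero p (u + i) =
            extendZero (fun i : Fin (u + k) => p i.castSucc) (u + i) := fun i hi => by
          simp only [extendZero, dif_pos (by omega : u + i < u + (k + 1)),
            dif_pos (by omega : u + i < u + k)]
          rfl
        rw [hlast, goodSets_congr hcong, goodSets_congr hcong]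
        rfl
    _ = ∫⁻ q : ℝ × (Fin (u + k) → ℝ), (G (q.2, x - q.1) + G (q.2, min x q.1))
          ∂((ν (u + k)).prod (Measure.pi fun i : Fin (u + k) => ν i)) := by
        rw [← hmp.lintegral_comp h12]
        refine lintegral_congr fun p => ?_
        have hp : MeasurableEquiv.piFinSuccAbove (fun _ => ℝ) (Fin.last (u + k)) p =
            (p (Fin.last _), fun i => p i.castSucc) := by
          exact Prod.ext rfl (funext fun i => congrArg p (Fin.succAbove_last_apply i))
        rw [hp]
    _ = _ := by
        rw [lintegral_prod _ h12.aemeasurable]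
        refine lintegral_congr fun y => ?_
        rw [hexp, hexp]
        exact lintegral_add_left (h1.comp measurable_prodMk_left) _

lemma isProbabilityMeasure_unifOn_Icc_s6 (a : ℝ) {δ : ℝ} (hδ : 0 < δ) :
    IsProbabilityMeasure (unifOn (Set.Icc a (a + δ))) := by
  constructor
  simp only [unifOn, Measure.smul_apply, Measure.restrict_apply_univ, smul_eq_mul,
    Real.volume_Icc]
  exact ENNReal.inv_mul_cancel (by simpa using hδ) ENNReal.ofReal_ne_top

lemma ae_mem_unifOn {s : Set ℝ} (hs : MeasurableSet s) : ∀ᵐ y ∂unifOn s, y ∈ s :=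
  Measure.ae_smul_measure (ae_restrict_mem hs) _

lemma unifOn_Icc_Ico {δ a b : ℝ} (hδ : 0 < δ) (ha : 0 ≤ a) (hb : b ≤ δ) :
    unifOn (Set.Icc 0 (0 + δ)) (Set.Ico a b) = ENNReal.ofReal ((b - a) / δ) := by
  have hsub : Set.Ico a b ⊆ Set.Icc 0 δ := fun y hy => ⟨ha.trans hy.1, hy.2.le.trans hb⟩
  simp only [unifOn, zero_add, Measure.smul_apply, smul_eq_mul,
    Measure.restrict_apply measurableSet_Ico, Set.inter_eq_left.2 hsub, Real.volume_Icc,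
    Real.volume_Ico, sub_zero]
  rw [mul_comm, ENNReal.ofReal_div_of_pos hδ, div_eq_mul_inv]

/-- With values uniform in `[0, δ]`, the expected number of good sets of deficit less than
`x ≤ δ` grows linearly. -/
lemma le_expectedGood {ν : ℕ → Measure ℝ} [∀ i, IsProbabilityMeasure (ν i)] {u : ℕ} {δ : ℝ}
    (hδ : 0 < δ) : ∀ {k : ℕ}, (∀ i < k, ν (u + i) = unifOn (Set.Icc 0 (0 + δ))) →
      ∀ {x : ℝ}, 0 < x → x ≤ δ → ENNReal.ofReal (1 + k * x / δ) ≤ expectedGood ν u k x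
  | 0, _, x, hx, _ => by simp [expectedGood_zero ν u hx]
  | k + 1, hν, x, hx, hxδ => by
    have ih : ∀ {z : ℝ}, 0 < z → z ≤ δ →
        ENNReal.ofReal (1 + k * z / δ) ≤ expectedGood ν u k z :=
      le_expectedGood hδ fun i hi => hν i (by omega)
    have hνk : ν (u + k) = unifOn (Set.Icc 0 (0 + δ)) := hν k (by omega)
    rw [expectedGood_succ]
    calc ENNReal.ofReal (1 + (k + 1 : ℕ) * x / δ)
        = ∫⁻ y, (ENNReal.ofReal (1 + k * x / δ) + (Set.Ico 0 x).indicator 1 y) ∂ν (u + k) := by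
          rw [lintegral_add_left measurable_const, lintegral_const, measure_univ, mul_one,
            lintegral_indicator_one measurableSet_Ico, hνk,
            unifOn_Icc_Ico hδ le_rfl hxδ, ← ENNReal.ofReal_add (by positivity) (by positivity)]
          simp
          ring_nf
      _ ≤ _ := by
          refine lintegral_mono_ae ?_
          have hpos : ∀ᵐ y ∂ν (u + k), y ≠ 0 := by
            rw [hνk]
            exact Measure.ae_smul_measure (ae_restrict_of_ae (by simp [ae_iff])) _
          have hmem : ∀ᵐ y ∂ν (u + k), y ∈ Set.Icc 0 (0 + δ) :=
            hνk ▸ ae_mem_unifOn measurableSet_Icc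
          filter_upwards [hpos, hmem] with y hy0 hy
          have hy0' : 0 < y := lt_of_le_of_ne hy.1 hy0.symm
          by_cases hyx : y < x
          · rw [Set.indicator_of_mem (show y ∈ Set.Ico 0 x from ⟨hy.1, hyx⟩), min_eq_right hyx.le]
            calc ENNReal.ofReal (1 + k * x / δ) + 1
                = ENNReal.ofReal (1 + k * (x - y) / δ) + ENNReal.ofReal (1 + k * y / δ) := by
                  have : 0 ≤ k * (x - y) / δ :=
                    div_nonneg (mul_nonneg (by positivity) (by linarith)) hδ.le
                  rw [← ENNReal.ofReal_one, ← ENNReal.ofReal_add (by positivity) one_pos.le,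
                    ← ENNReal.ofReal_add (by positivity) (by positivity)]
                  ring_nf
              _ ≤ _ := add_le_add (ih (by linarith) (by linarith)) (ih hy0' (by linarith))
          · rw [Set.indicator_of_notMem (fun h => hyx h.2), add_zero,
              min_eq_left (not_lt.1 hyx)]
            exact (ih hx hxδ).trans le_add_self

/-- With `k` values uniform in `[0, δ]` there are quadratically many good sets in expectation. -/
lemma sq_le_expectedGood {ν : ℕ → Measure ℝ} [∀ i, IsProbabilityMeasure (ν i)] {u : ℕ} {δ : ℝ}
    (hδ : 0 < δ) : ∀ {k : ℕ}, (∀ i < k, ν (u + i) = unifOn (Set.Icc 0 (0 + δ))) →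
      ∀ {x : ℝ}, (k + 1) * δ ≤ x → ENNReal.ofReal (k ^ 2 / 8) ≤ expectedGood ν u k x
  | 0, _, x, _ => by simp
  | k + 1, hν, x, hx => by
    have hν' : ∀ i < k, ν (u + i) = unifOn (Set.Icc 0 (0 + δ)) := fun i hi => hν i (by omega)
    have hνk : ν (u + k) = unifOn (Set.Icc 0 (0 + δ)) := hν k (by omega)
    push_cast at hx
    have hkδ : 0 ≤ k * δ := by positivity
    rw [expectedGood_succ]
    calc ENNReal.ofReal ((k + 1 : ℕ) ^ 2 / 8)
        ≤ ENNReal.ofReal (k ^ 2 / 8) + ENNReal.ofReal (1 + k / 2) * ENNReal.ofReal (1 / 2) := by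
          rw [← ENNReal.ofReal_mul (by positivity), ← ENNReal.ofReal_add (by positivity)
            (by positivity)]
          refine ENNReal.ofReal_le_ofReal ?_
          push_cast
          nlinarith
      _ = ∫⁻ y, (ENNReal.ofReal (k ^ 2 / 8) +
            (Set.Ico (δ / 2) δ).indicator (fun _ => ENNReal.ofReal (1 + k / 2)) y)
            ∂ν (u + k) := by
          rw [lintegral_add_left measurable_const, lintegral_const, measure_univ, mul_one,
            lintegral_indicator_const measurableSet_Ico, hνk,
            unifOn_Icc_Ico hδ (by positivity) le_rfl,
            (by field_simp; norm_num : (δ - δ / 2) / δ = 1 / 2)]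
      _ ≤ _ := by
          refine lintegral_mono_ae ?_
          have hmem : ∀ᵐ y ∂ν (u + k), y ∈ Set.Icc 0 (0 + δ) :=
            hνk ▸ ae_mem_unifOn measurableSet_Icc
          filter_upwards [hmem] with y hy
          have hy2 : y ≤ δ := by linarith [hy.2]
          refine add_le_add (sq_le_expectedGood hδ hν' (by linarith)) ?_
          refine Set.indicator_apply_le' (fun hyi => ?_) fun _ => zero_le
          rw [min_eq_right (by linarith)]
          refine le_trans (ENNReal.ofReal_le_ofReal ?_)
            (le_expectedGood hδ hν' (by linarith [hyi.1]) hy2)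
          rw [mul_div_assoc]
          have : 1 / 2 ≤ y / δ := by
            rw [le_div_iff₀ hδ]
            linarith [hyi.1]
          nlinarith [Nat.cast_nonneg (α := ℝ) k]

/-- Objects whose value exceeds the total value of their predecessors double the number of
good sets. -/
lemma two_pow_mul_le_expectedGood {ν : ℕ → Measure ℝ} [∀ i, IsProbabilityMeasure (ν i)]
    {u m : ℕ} {δ : ℝ} (hδ : 0 < δ) (hν : ∀ i < m, ν (u + i) = unifOn (Set.Icc 0 (0 + δ))) :
    ∀ {l : ℕ}, (∀ i < l, ν (u + (m + i)) = unifOn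
      (Set.Icc ((2 ^ i * (m + 2) - 1) * δ) ((2 ^ i * (m + 2) - 1) * δ + δ))) →
      ∀ {x : ℝ}, (2 ^ l * (m + 2) - 1) * δ ≤ x →
        2 ^ l * ENNReal.ofReal (m ^ 2 / 8) ≤ expectedGood ν u (m + l) x
  | 0, _, x, hx => by
    simpa using sq_le_expectedGood hδ hν (by linarith)
  | l + 1, hνl, x, hx => by
    have ih : ∀ {z : ℝ}, (2 ^ l * (m + 2) - 1) * δ ≤ z →
        2 ^ l * ENNReal.ofReal (m ^ 2 / 8) ≤ expectedGood ν u (m + l) z :=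
      two_pow_mul_le_expectedGood hδ hν fun i hi => hνl i (by omega)
    have hνk := hνl l (by omega)
    rw [pow_succ] at hx
    rw [← add_assoc, expectedGood_succ]
    calc 2 ^ (l + 1) * ENNReal.ofReal (m ^ 2 / 8)
        = ∫⁻ _, (2 ^ l * ENNReal.ofReal (m ^ 2 / 8) + 2 ^ l * ENNReal.ofReal (m ^ 2 / 8))
            ∂ν (u + (m + l)) := by
          rw [lintegral_const, measure_univ]
          ring
      _ ≤ _ := by
          refine lintegral_mono_ae ?_
          have hmem := ae_mem_unifOn (s := Set.Icc ((2 ^ l * ((m : ℝ) + 2) - 1) * δ)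
            ((2 ^ l * (m + 2) - 1) * δ + δ)) measurableSet_Icc
          rw [← hνk] at hmem
          filter_upwards [hmem] with y hy
          have h0 : 0 ≤ 2 ^ l * ((m : ℝ) + 2) * δ := by positivity
          refine add_le_add (ih (by linarith [hy.2])) (ih (le_min (by linarith) hy.1))

/-- Left endpoints of the profit intervals: `m` profits close to one, `m` profits close to zero,
and profits that roughly double. -/
noncomputable def leftEndpoint (m : ℕ) (φ : ℝ) (i : ℕ) : ℝ :=
  if i < m then 1 - 1 / φ else if i < m + m then 0
    else (2 ^ (i - (m + m)) * (m + 2) - 1) * (1 / φ)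

lemma leftEndpoint_bounds {m l : ℕ} {φ : ℝ} (hφ : 1 ≤ φ)
    (hl : ∀ i < l, 2 ^ i * ((m : ℝ) + 2) ≤ φ) {i : ℕ} (hi : i < m + (m + l)) :
    0 ≤ leftEndpoint m φ i ∧ leftEndpoint m φ i + 1 / φ ≤ 1 := by
  have hφ0 : 0 < φ := by linarith
  have h1 : 1 / φ ≤ 1 := (div_le_one hφ0).2 hφ
  have h0 : 0 < 1 / φ := by positivity
  unfold leftEndpoint
  split_ifs
  · exact ⟨by linarith, by linarith⟩
  · exact ⟨le_rfl, by linarith⟩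
  · have h2 := hl (i - (m + m)) (by omega)
    have h3 : (1 : ℝ) ≤ 2 ^ (i - (m + m)) := one_le_pow₀ (by norm_num)
    have h4 : 2 ^ (i - (m + m)) * ((m : ℝ) + 2) * (1 / φ) ≤ 1 := by
      rw [mul_one_div]
      exact (div_le_one hφ0).2 h2
    refine ⟨mul_nonneg ?_ h0.le, by linarith⟩
    nlinarith [Nat.cast_nonneg (α := ℝ) m]

lemma exists_expected_pareto_ge {m l g J : ℕ} {φ : ℝ} (hφ : 1 ≤ φ)
    (hl : ∀ i < l, 2 ^ i * ((m : ℝ) + 2) ≤ φ) (hg : 1 ≤ g) (hJ : J * g ≤ m)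
    (hgap : 2 ^ l * ((m : ℝ) + 2) - 1 ≤ g * (φ - 1)) :
    ∃ (S : Set (Fin (m + (m + l)) → Bool)) (w a : Fin (m + (m + l)) → ℝ),
      (∀ i, 0 ≤ a i ∧ a i + 1 / φ ≤ 1) ∧
      ENNReal.ofReal (((J : ℝ) + 1) * (2 ^ l * ((m : ℝ) ^ 2 / 8))) ≤
        ∫⁻ p : Fin (m + (m + l)) → ℝ, ((paretoSet S w p).ncard : ENNReal)
          ∂(Measure.pi fun i => unifOn (Set.Icc (a i) (a i + 1 / φ))) := by
  have hφ0 : 0 < φ := by linarith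
  have hδ : 0 < 1 / φ := by positivity
  have hδ1 : 1 / φ ≤ 1 := (div_le_one hφ0).2 hφ
  have hbounds := fun {i} => leftEndpoint_bounds (m := m) (l := l) hφ hl (i := i)
  set ν : ℕ → Measure ℝ := fun i =>
    unifOn (Set.Icc (leftEndpoint m φ i) (leftEndpoint m φ i + 1 / φ)) with hν
  have hprob : ∀ i, IsProbabilityMeasure (ν i) := fun i => isProbabilityMeasure_unifOn_Icc_s6 _ hδ
  refine ⟨prefixSolutions m (m + l) g J, binaryWeights m (m + l), fun i => leftEndpoint m φ i,
    fun i => hbounds i.2, ?_⟩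
  have hx : (2 ^ l * ((m : ℝ) + 2) - 1) * (1 / φ) ≤ g * (1 - 1 / φ) := by
    rw [mul_one_div, div_le_iff₀ hφ0, mul_assoc, sub_mul, one_div, inv_mul_cancel₀ hφ0.ne',
      one_mul]
    exact hgap
  have hmain : 2 ^ l * ENNReal.ofReal ((m : ℝ) ^ 2 / 8) ≤
      expectedGood ν m (m + l) (g * (1 - 1 / φ)) := by
    refine two_pow_mul_le_expectedGood hδ (fun i hi => ?_) (fun i hi => ?_) hx
    · simp [hν, leftEndpoint, hi]
    · have h1 : m + (m + i) - (m + m) = i := by omega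
      simp [hν, leftEndpoint, h1]
  calc ENNReal.ofReal (((J : ℝ) + 1) * (2 ^ l * ((m : ℝ) ^ 2 / 8)))
      = (J + 1 : ℕ) * (2 ^ l * ENNReal.ofReal ((m : ℝ) ^ 2 / 8)) := by
        rw [ENNReal.ofReal_mul (by positivity), ENNReal.ofReal_mul (by positivity)]
        congr 2
        · rw [← ENNReal.ofReal_natCast]
          push_cast
          rfl
        · rw [ENNReal.ofReal_pow (by norm_num)]
          simp
    _ ≤ (J + 1 : ℕ) * expectedGood ν m (m + l) (g * (1 - 1 / φ)) := by gcongr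
    _ = ∫⁻ p : Fin (m + (m + l)) → ℝ, (J + 1 : ℕ) *
          ((goodSets (fun i => extendZero p (m + i)) (m + l) (g * (1 - 1 / φ))).card : ENNReal)
          ∂(Measure.pi fun i : Fin (m + (m + l)) => ν i) :=
        (lintegral_const_mul' _ _ (ENNReal.natCast_ne_top _)).symm
    _ ≤ _ := by
        refine lintegral_mono_ae ?_
        have hmem : ∀ᵐ p ∂(Measure.pi fun i : Fin (m + (m + l)) => ν i),
            ∀ i : Fin (m + (m + l)),
            p i ∈ Set.Icc (leftEndpoint m φ i) (leftEndpoint m φ i + 1 / φ) :=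
          ae_all_iff.2 fun i => (Measure.tendsto_eval_ae_ae (i := i)).eventually
            (ae_mem_unifOn measurableSet_Icc)
        filter_upwards [hmem] with p hp
        have hp' : ∀ i < m + (m + l), leftEndpoint m φ i ≤ extendZero p i := fun i hi => by
          simpa [extendZero, hi] using (hp ⟨i, hi⟩).1
        rw [← Nat.cast_mul]
        refine Nat.cast_le.2 (card_mul_le_ncard_paretoSet hg hJ (L := 1 - 1 / φ)
          (by linarith) le_rfl p (fun i hi => ?_) fun i hi => ?_)
        · simpa [leftEndpoint, hi] using hp' i (by omega)
        · exact (hbounds (by omega)).1.trans (hp' (m + i) (by omega))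

/-- Parameters for which the problem of `exists_expected_pareto_ge` has the desired number of Pareto
optimal solutions. -/
lemma exists_parameters {m : ℕ} (hm : 1 ≤ m) {φ : ℝ} (hφ : 5 / 2 ≤ φ) :
    ∃ l g J : ℕ, l ≤ m ∧ (∀ i < l, 2 ^ i * ((m : ℝ) + 2) ≤ φ) ∧ 1 ≤ g ∧ J * g ≤ m ∧
      2 ^ l * ((m : ℝ) + 2) - 1 ≤ g * (φ - 1) ∧
      min ((m : ℝ) ^ 2 * φ / 60) ((2 : ℝ) ^ m / 4) ≤ ((J : ℝ) + 1) * (2 ^ l * ((m : ℝ) ^ 2 / 8)) := by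
  have hm1 : (1 : ℝ) ≤ m := by exact_mod_cast hm
  rcases lt_or_ge φ (m + 2) with hlt | hge
  · have hφ1 : 0 < φ - 1 := by linarith
    set g := ⌈((m : ℝ) + 1) / (φ - 1)⌉₊ with hg
    have hge1 : 1 ≤ ((m : ℝ) + 1) / (φ - 1) := by
      rw [le_div_iff₀ hφ1]
      linarith
    have hg1 : ((m : ℝ) + 1) / (φ - 1) ≤ g := Nat.le_ceil _
    have hg2 : (g : ℝ) < ((m : ℝ) + 1) / (φ - 1) + 1 := Nat.ceil_lt_add_one (by positivity)
    have hgpos : 0 < g := by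
      have : (0 : ℝ) < g := by linarith
      exact_mod_cast this
    refine ⟨0, g, m / g, by simp, by simp, hgpos, Nat.div_mul_le_self m g, ?_,
      (min_le_left _ _).trans ?_⟩
    · rw [div_le_iff₀ hφ1] at hg1
      linarith
    · have h1 : (m : ℝ) < ((m / g : ℕ) + 1) * g := by
        have := Nat.lt_mul_div_succ m hgpos
        rw [mul_comm] at this
        exact_mod_cast this
      have h2 : (g : ℝ) * (φ - 1) ≤ 4 * m := by
        have h3 : (g : ℝ) ≤ 2 * (((m : ℝ) + 1) / (φ - 1)) := by linarith
        rw [← mul_div_assoc, le_div_iff₀ hφ1] at h3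
        linarith
      have h4 : φ * (3 / 20) ≤ (m / g : ℕ) + 1 := by
        by_contra! h
        have h5 : (m : ℝ) < φ * (3 / 20) * g :=
          h1.trans (mul_lt_mul_of_pos_right h (by exact_mod_cast hgpos))
        have h6 : (0 : ℝ) < g := by exact_mod_cast hgpos
        nlinarith
      have h5 := mul_le_mul_of_nonneg_right h4 (sq_nonneg (m : ℝ))
      linarith [show 0 ≤ φ * (m : ℝ) ^ 2 by positivity]
  · classical
    set P : ℕ → Prop := fun l => 2 ^ l * ((m : ℝ) + 2) ≤ φ with hP
    have hl : P (Nat.findGreatest P m) :=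
      Nat.findGreatest_spec (P := P) (Nat.zero_le m) (by simpa [hP] using hge)
    have hlm : Nat.findGreatest P m ≤ m := Nat.findGreatest_le m
    have hgreatest : Nat.findGreatest P m < m → ¬ P (Nat.findGreatest P m + 1) := fun h =>
      Nat.findGreatest_is_greatest (Nat.lt_succ_self _) h
    generalize Nat.findGreatest P m = l at hl hlm hgreatest
    simp only [hP, not_le] at hl hgreatest
    refine ⟨l, 1, m, hlm, fun i hi => le_trans ?_ hl, le_rfl, by simp, by simpa using hl, ?_⟩
    · gcongr
      norm_num
    have hm2 : (1 : ℝ) ≤ m ^ 2 := one_le_pow₀ hm1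
    rcases hlm.eq_or_lt with rfl | hlt
    · refine (min_le_right _ _).trans ?_
      have h2 : (0 : ℝ) < 2 ^ l := by positivity
      have h3 : (2 : ℝ) ≤ l + 1 := by linarith
      have h4 : (2 : ℝ) ^ l * (1 / 8) ≤ 2 ^ l * ((l : ℝ) ^ 2 / 8) := by gcongr
      nlinarith
    · refine (min_le_left _ _).trans ?_
      have h1 := hgreatest hlt
      rw [pow_succ] at h1
      have h2 : (0 : ℝ) < 2 ^ l := by positivity
      have h3 : φ / 3 ≤ (m + 1) * 2 ^ l := by nlinarith
      have h4 := mul_le_mul_of_nonneg_right h3 (sq_nonneg (m : ℝ))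
      linarith [show 0 ≤ φ * (m : ℝ) ^ 2 by positivity]

/-- main bi-criteria lower bound. There are constants
`c, α, β > 0` such that for every `n ≥ 4` and `φ ≥ (3+√5)/2` there is an instance
of the bi-criteria knapsack problem with groups on `N ≤ n` objects, with weights
`w_i` and profits drawn independently and uniformly from subintervals of `[0,1]`
of length `1/φ` (hence with densities bounded by `φ`), whose expected number of
Pareto optimal solutions is at least `c · min(n²·φ^{1-α/φ}, 2^{βn})`. -/
theorem main_bicriteria_lower_bound : ∃ c α β : ℝ, 0 < c ∧ 0 < α ∧ 0 < β ∧
    ∀ n : ℕ, 4 ≤ n → ∀ φ : ℝ, (3 + Real.sqrt 5) / 2 ≤ φ →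
    ∃ N : ℕ, N ≤ n ∧
    ∃ (S : Set (Fin N → Bool)) (w : Fin N → ℝ) (a : Fin N → ℝ),
      (∀ i, 0 ≤ a i ∧ a i + 1 / φ ≤ 1) ∧
      ENNReal.ofReal (c * min ((n : ℝ) ^ 2 * φ ^ (1 - α / φ))
          ((2 : ℝ) ^ (β * n))) ≤
        ∫⁻ p : Fin N → ℝ, ((paretoSet S w p).ncard : ENNReal)
          ∂(Measure.pi fun i : Fin N => unifOn (Set.Icc (a i) (a i + 1 / φ))) := by
  refine ⟨1 / 2000, 1, 1 / 3, by norm_num, by norm_num, by norm_num, fun n hn φ hφ => ?_⟩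
  have hφ' : 5 / 2 ≤ φ := by
    have : (2 : ℝ) ≤ Real.sqrt 5 := Real.le_sqrt_of_sq_le (by norm_num)
    linarith
  obtain ⟨m, hm⟩ : ∃ m, m = n / 3 := ⟨_, rfl⟩
  have hm1 : 1 ≤ m := by omega
  obtain ⟨l, g, J, hlm, hl, hg, hJ, hgap, hmin⟩ := exists_parameters hm1 hφ'
  obtain ⟨S, w, a, ha, hS⟩ := exists_expected_pareto_ge (by linarith) hl hg hJ hgap
  refine ⟨m + (m + l), by omega, S, w, a, ha, le_trans (ENNReal.ofReal_le_ofReal ?_) hS⟩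
  refine le_trans ?_ hmin
  have hpow : φ ^ (1 - 1 / φ) ≤ φ := by
    conv_rhs => rw [← Real.rpow_one φ]
    exact Real.rpow_le_rpow_of_exponent_le (by linarith)
      (by linarith [show (0 : ℝ) ≤ 1 / φ by positivity])
  refine le_min ?_ ?_
  · have hn5 : (n : ℝ) ≤ 5 * m := by exact_mod_cast (by omega : n ≤ 5 * m)
    have hsq : (n : ℝ) ^ 2 ≤ 25 * m ^ 2 := by nlinarith [Nat.cast_nonneg (α := ℝ) n]
    calc 1 / 2000 * min ((n : ℝ) ^ 2 * φ ^ (1 - 1 / φ)) (2 ^ (1 / 3 * (n : ℝ)))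
        ≤ 1 / 2000 * (25 * m ^ 2 * φ) := by
          gcongr
          exact (min_le_left _ _).trans (by gcongr)
      _ ≤ _ := by nlinarith [show 0 ≤ (m : ℝ) ^ 2 * φ by positivity]
  · have hn3 : 1 / 3 * (n : ℝ) ≤ (m + 1 : ℕ) := by
      have : (n : ℝ) ≤ 3 * (m + 1 : ℕ) := by exact_mod_cast (by omega : n ≤ 3 * (m + 1))
      linarith
    calc 1 / 2000 * min ((n : ℝ) ^ 2 * φ ^ (1 - 1 / φ)) (2 ^ (1 / 3 * (n : ℝ)))
        ≤ 1 / 2000 * (2 : ℝ) ^ (m + 1) := by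
          gcongr
          refine (min_le_right _ _).trans ?_
          rw [← Real.rpow_natCast]
          exact Real.rpow_le_rpow_of_exponent_le (by norm_num) hn3
      _ ≤ _ := by
          rw [pow_succ]
          nlinarith [show (0 : ℝ) < 2 ^ m by positivity]
end

section
/- For every fixed integer d ≥ 2 there exist constants c_d, α_d, β_d > 0 such that for every integer n ≥ 16d and every real φ ≥ 2d there exist an integer N ≤ n, a solution set S ⊆ {0,1}^N, weights w_1,...,w_N ∈ ℝ, and for each i = 1,...,N and j = 1,...,d an interval I_{i,j} ⊆ [−1,1] of length 1/φ such that, when the profits (p_i)_j are drawn independently and uniformly from I_{i,j} (so each profit density is bounded by φ), the expected number of Pareto optimal solutions of the (d+1)-dimensional problem K_S (minimize Σ w_i s_i, maximize Σ (p_i)_j s_i for each j, over s ∈ S) is at least c_d · min( (nφ)^{(d − log₂ d)·(1 − α_d/φ)}, 2^{β_d · n} ). -/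
open MeasureTheory Finset

/-- Multi-criteria domination: `s'` is no heavier, has no smaller profit in each of
the `d` profit criteria, and is strictly better in at least one of the `d+1` criteria. -/
def dominatesD {ι : Type*} [Fintype ι] {d : ℕ} (w : ι → ℝ) (P : ι → Fin d → ℝ)
    (s' s : ι → Bool) : Prop :=
  totalVal w s' ≤ totalVal w s ∧
    (∀ j, totalVal (fun i => P i j) s ≤ totalVal (fun i => P i j) s') ∧
    (totalVal w s' < totalVal w s ∨
      ∃ j, totalVal (fun i => P i j) s < totalVal (fun i => P i j) s')

/-- Pareto set of the `(d+1)`-dimensional knapsack problem with solution set `S`,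
weights `w` and profit vectors `P`. -/
def paretoSetD {ι : Type*} [Fintype ι] {d : ℕ} (S : Set (ι → Bool)) (w : ι → ℝ)
    (P : ι → Fin d → ℝ) : Set (ι → Bool) :=
  {s ∈ S | ∀ s' ∈ S, ¬ dominatesD w P s' s}

/-- Sums of nonnegative bounded terms compare according to the last index at which the
arguments differ, provided the gap there exceeds the total range of all earlier terms. -/
lemma sum_lt_sum_of_last_diff {L : ℕ} {τ : Type*} (g : Fin L → τ → ℝ) (b : Fin L → ℝ)
    (f f' : Fin L → τ) (i : Fin L) (htop : ∀ l, i < l → f l = f' l)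
    (h0 : ∀ l T, 0 ≤ g l T) (hb : ∀ l T, g l T ≤ b l)
    (hi : g i (f i) + ∑ l ∈ Finset.Iio i, b l < g i (f' i)) :
    ∑ l, g l (f l) < ∑ l, g l (f' l) := by
  have key : ∀ l ∈ (Finset.univ : Finset (Fin L)), g l (f l) ≤ g l (f' l) +
      ((if l ∈ Finset.Iio i then b l else 0) +
        (if l = i then g i (f i) - g i (f' i) else 0)) := by
    intro l _
    rcases lt_trichotomy l i with h | h | h
    · have h1 := h0 l (f' l)
      have h2 := hb l (f l)
      simp only [Finset.mem_Iio, h, if_true, h.ne, if_false]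
      linarith
    · subst h
      simp
    · simp [h.not_gt, h.ne', htop l h]
  have := Finset.sum_le_sum key
  rw [Finset.sum_add_distrib, Finset.sum_add_distrib, Finset.sum_ite_mem,
    Finset.univ_inter, Finset.sum_ite_eq' Finset.univ i] at this
  simp only [Finset.mem_univ, if_true] at this
  linarith

/-- Two distinct functions on `Fin L` have a last index at which they differ. -/
lemma exists_last_diff {L : ℕ} {τ : Type*} {f f' : Fin L → τ} (h : f ≠ f') :
    ∃ i, f i ≠ f' i ∧ ∀ l, i < l → f l = f' l := by
  classical
  obtain ⟨j, hj⟩ := Function.ne_iff.mp h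
  obtain ⟨i, hi, hmax⟩ := (Finset.univ.filter fun i => f i ≠ f' i).exists_max_image id
    ⟨j, by simpa using hj⟩
  refine ⟨i, by simpa using hi, fun l hl => ?_⟩
  by_contra hne
  exact (hmax l (by simpa using hne)).not_gt hl

/-- The sum of the earlier values of a function of the underlying natural number. -/
lemma sum_Iio_fin {L : ℕ} (i : Fin L) (b : ℕ → ℝ) :
    ∑ l ∈ Finset.Iio i, b l = ∑ l ∈ Finset.range i, b l := by
  rw [← Nat.Iio_eq_range, ← Fin.map_valEmbedding_Iio, Finset.sum_map]
  rfl

/-- At every level `i`, the solution takes all `k i` objects of the block labelled `f i`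
and no object of any other block of that level. -/
def blockSol {ι τ : Type*} [DecidableEq τ] {L : ℕ} {k : Fin L → ℕ}
    (e : ι ≃ Σ i : Fin L, τ × Fin (k i)) (f : Fin L → τ) : ι → Bool :=
  fun x => decide (f (e x).1 = (e x).2.1)

lemma label_apply_symm {ι τ : Type*} {L : ℕ} {k : Fin L → ℕ}
    (e : ι ≃ Σ i : Fin L, τ × Fin (k i)) (i : Fin L) (T : τ) (m : Fin (k i)) :
    (e (e.symm ⟨i, (T, m)⟩)).2.1 = T := by
  rw [Equiv.apply_symm_apply]

lemma totalVal_blockSol {ι τ : Type*} [Fintype ι] [Fintype τ] [DecidableEq τ] {L : ℕ}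
    {k : Fin L → ℕ} (e : ι ≃ Σ i : Fin L, τ × Fin (k i)) (f : Fin L → τ) (v : ι → ℝ) :
    totalVal v (blockSol e f) = ∑ i, ∑ m : Fin (k i), v (e.symm ⟨i, (f i, m)⟩) := by
  unfold totalVal blockSol
  rw [← Equiv.sum_comp e.symm, Fintype.sum_sigma]
  refine Finset.sum_congr rfl fun i _ => ?_
  rw [Fintype.sum_prod_type, Finset.sum_eq_single (f i)]
  · simp [label_apply_symm]
  · intro T _ hT
    simp [label_apply_symm, hT.symm]
  · simp

lemma blockSol_injective {ι τ : Type*} [DecidableEq τ] {L : ℕ}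
    {k : Fin L → ℕ} (hk : ∀ i, 0 < k i) (e : ι ≃ Σ i : Fin L, τ × Fin (k i)) :
    Function.Injective (blockSol e) := by
  intro f f' h
  funext i
  have := congrFun h (e.symm ⟨i, (f i, ⟨0, hk i⟩)⟩)
  simp only [blockSol, Equiv.apply_symm_apply, label_apply_symm, decide_true] at this
  exact (by simpa using this : f' i = f i).symm

lemma isProbabilityMeasure_unifOn_Icc_s15 (x : ℝ) {ε : ℝ} (hε : 0 < ε) :
    IsProbabilityMeasure (unifOn (Set.Icc x (x + ε))) := by
  constructor
  simp only [unifOn, Measure.smul_apply, Measure.restrict_apply_univ, smul_eq_mul]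
  apply ENNReal.inv_mul_cancel <;> simp [hε]

lemma unifOn_Icc_self (x : ℝ) {ε : ℝ} (hε : 0 < ε) :
    unifOn (Set.Icc x (x + ε)) (Set.Icc x (x + ε)) = 1 := by
  simp only [unifOn, Measure.smul_apply, Measure.restrict_apply_self, smul_eq_mul]
  apply ENNReal.inv_mul_cancel <;> simp [hε]

/-- A constant that bounds `F` from below on the box bounds its expectation from below. -/
lemma le_lintegral_unif_of_forall_mem {ι κ : Type*} [Fintype ι] [Fintype κ]
    (a : ι → κ → ℝ) {ε : ℝ} (hε : 0 < ε) (C : ENNReal) (F : (ι → κ → ℝ) → ENNReal)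
    (hF : ∀ p : ι → κ → ℝ, (∀ i j, p i j ∈ Set.Icc (a i j) (a i j + ε)) → C ≤ F p) :
    C ≤ ∫⁻ p, F p ∂(Measure.pi fun i : ι => Measure.pi fun j : κ =>
      unifOn (Set.Icc (a i j) (a i j + ε))) := by
  have := fun i j => isProbabilityMeasure_unifOn_Icc_s15 (a i j) hε
  set μ := Measure.pi fun i : ι => Measure.pi fun j : κ =>
      unifOn (Set.Icc (a i j) (a i j + ε))
  set B : Set (ι → κ → ℝ) :=
    Set.univ.pi fun i => Set.univ.pi fun j => Set.Icc (a i j) (a i j + ε)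
  have hBm : MeasurableSet B :=
    MeasurableSet.univ_pi fun i => MeasurableSet.univ_pi fun j => measurableSet_Icc
  have hB : μ B = 1 := by
    simp only [μ, B, Measure.pi_pi, unifOn_Icc_self _ hε, Finset.prod_const_one]
  calc C = ∫⁻ _ in B, C ∂μ := by rw [setLIntegral_const, hB, mul_one]
    _ ≤ ∫⁻ p in B, F p ∂μ := setLIntegral_mono' hBm fun p hp => hF p fun i j =>
        hp i (Set.mem_univ i) j (Set.mem_univ j)
    _ ≤ ∫⁻ p, F p ∂μ := setLIntegral_le_lintegral _ _

/-- If the block sums separate the levels in every profit coordinate and the weights are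
lexicographic in the cardinalities of the labels, every block solution is Pareto optimal. -/
lemma paretoSetD_range_blockSol {ι : Type*} [Fintype ι] {d L : ℕ} {k : Fin L → ℕ}
    (e : ι ≃ Σ i : Fin L, Finset (Fin d) × Fin (k i)) (w : ι → ℝ) (p : ι → Fin d → ℝ)
    (D δ : Fin L → ℝ)
    (hw : ∀ i T, ∑ m : Fin (k i), w (e.symm ⟨i, (T, m)⟩) = ((d : ℝ) + 1) ^ (i : ℕ) * T.card)
    (h0 : ∀ i T j, 0 ≤ ∑ m : Fin (k i), p (e.symm ⟨i, (T, m)⟩) j)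
    (h1 : ∀ i T j, ∑ m : Fin (k i), p (e.symm ⟨i, (T, m)⟩) j ≤ D i)
    (hin : ∀ i T, ∀ j ∈ T, D i - δ i ≤ ∑ m : Fin (k i), p (e.symm ⟨i, (T, m)⟩) j)
    (hout : ∀ i T, ∀ j ∉ T, ∑ m : Fin (k i), p (e.symm ⟨i, (T, m)⟩) j ≤ δ i)
    (hD : ∀ i, ∑ l ∈ Finset.Iio i, D l + 2 * δ i < D i) :
    paretoSetD (Set.range (blockSol e)) w p = Set.range (blockSol e) := by
  refine Set.Subset.antisymm (fun s hs => hs.1) ?_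
  rintro _ ⟨f, rfl⟩
  refine ⟨⟨f, rfl⟩, ?_⟩
  rintro _ ⟨f', rfl⟩ ⟨hwle, hple, hstrict⟩
  have hne : f ≠ f' := by
    rintro rfl
    simp at hstrict
  obtain ⟨i, hi, htop⟩ := exists_last_diff hne
  have hsub : f i ⊆ f' i := by
    intro j hj
    by_contra hj'
    have hlt := sum_lt_sum_of_last_diff
      (fun i T => ∑ m : Fin (k i), p (e.symm ⟨i, (T, m)⟩) j) D f' f i
      (fun l hl => (htop l hl).symm) (fun l T => h0 l T j) (fun l T => h1 l T j)
      (by linarith [hin i (f i) j hj, hout i (f' i) j hj', hD i])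
    have := hple j
    rw [totalVal_blockSol, totalVal_blockSol] at this
    linarith
  have hcard : ((f i).card : ℝ) + 1 ≤ (f' i).card := by
    exact_mod_cast Finset.card_lt_card (Finset.ssubset_iff_subset_ne.mpr ⟨hsub, hi⟩)
  have hpow : ∀ m : ℕ, 0 < ((d : ℝ) + 1) ^ m := fun m => by positivity
  have hlt := sum_lt_sum_of_last_diff
    (fun i (T : Finset (Fin d)) => ((d : ℝ) + 1) ^ (i : ℕ) * T.card)
    (fun i => ((d : ℝ) + 1) ^ (i : ℕ) * d) f f' i htop
    (fun l T => by positivity)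
    (fun l T => by
      have : (T.card : ℝ) ≤ d := by exact_mod_cast (by simpa using Finset.card_le_univ T)
      exact mul_le_mul_of_nonneg_left this (hpow l).le)
    (by
      rw [sum_Iio_fin i fun l => ((d : ℝ) + 1) ^ l * d, ← Finset.sum_mul]
      have hg := geom_sum_mul ((d : ℝ) + 1) i
      rw [add_sub_cancel_right] at hg
      rw [hg]
      nlinarith [hpow i])
  rw [totalVal_blockSol, totalVal_blockSol] at hwle
  simp only [hw] at hwle
  linarith

/-- With `k i` objects in each of the `2 ^ d` blocks of level `i` and sufficiently separated
levels `D i`, there is an instance all of whose `2 ^ (d * L)` solutions are Pareto optimal. -/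
lemma exists_instance_of_levels (d L : ℕ) {φ : ℝ} (hφ : 1 ≤ φ) (k : Fin L → ℕ)
    (D : Fin L → ℝ) (hk : ∀ i, 0 < k i) (hDk : ∀ i, D i ≤ k i)
    (hD0 : ∀ i, 0 ≤ D i)
    (hD : ∀ i, ∑ l ∈ Finset.Iio i, D l + 2 * (k i / φ) < D i) :
    ∃ (S : Set (Fin (∑ i, 2 ^ d * k i) → Bool)) (w : Fin (∑ i, 2 ^ d * k i) → ℝ)
      (a : Fin (∑ i, 2 ^ d * k i) → Fin d → ℝ),
      (∀ i j, -1 ≤ a i j ∧ a i j + 1 / φ ≤ 1) ∧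
      ((2 ^ (d * L) : ℕ) : ENNReal) ≤
        ∫⁻ p : Fin (∑ i, 2 ^ d * k i) → Fin d → ℝ, ((paretoSetD S w p).ncard : ENNReal)
          ∂(Measure.pi fun i => Measure.pi fun j : Fin d =>
              unifOn (Set.Icc (a i j) (a i j + 1 / φ))) := by
  have hφ0 : 0 < φ := by linarith
  have e : Fin (∑ i, 2 ^ d * k i) ≃ Σ i : Fin L, Finset (Fin d) × Fin (k i) :=
    (Fintype.equivFinOfCardEq (by simp)).symm
  have hkR : ∀ i, (0 : ℝ) < k i := fun i => by exact_mod_cast hk i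
  have hφ1 : 1 / φ ≤ 1 := by rw [div_le_one hφ0]; exact hφ
  have hD2 : ∀ i, 2 * (k i / φ) < D i := fun i => by
    have : 0 ≤ ∑ l ∈ Finset.Iio i, D l := Finset.sum_nonneg fun l _ => hD0 l
    linarith [hD i]
  have hDdiv : ∀ i, 2 * (1 / φ) < D i / k i := fun i => by
    rw [lt_div_iff₀ (hkR i)]
    calc _ = 2 * (k i / φ) := by ring
      _ < _ := hD2 i
  have hDdiv1 : ∀ i, D i / k i ≤ 1 := fun i => by
    rw [div_le_one (hkR i)]; exact hDk i
  have hε : 0 < 1 / φ := by positivity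
  set a : Fin (∑ i, 2 ^ d * k i) → Fin d → ℝ := fun x j =>
    if j ∈ (e x).2.1 then D (e x).1 / k (e x).1 - 1 / φ else 0 with ha
  refine ⟨Set.range (blockSol e),
    fun x => ((d : ℝ) + 1) ^ ((e x).1 : ℕ) * (e x).2.1.card / k (e x).1, a, ?_, ?_⟩
  · intro x j
    simp only [ha]
    have h1 := hDdiv (e x).1
    have h2 := hDdiv1 (e x).1
    split_ifs <;> constructor <;> linarith
  · refine le_lintegral_unif_of_forall_mem a hε _ _ fun p hp => ?_
    have hlow : ∀ i T j m, (if j ∈ T then D i / k i - 1 / φ else 0) ≤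
        p (e.symm ⟨i, (T, m)⟩) j := fun i T j m => by
      simpa [ha, label_apply_symm] using (hp (e.symm ⟨i, (T, m)⟩) j).1
    have hupp : ∀ i T j m, p (e.symm ⟨i, (T, m)⟩) j ≤
        (if j ∈ T then D i / k i - 1 / φ else 0) + 1 / φ := fun i T j m => by
      simpa [ha, label_apply_symm] using (hp (e.symm ⟨i, (T, m)⟩) j).2
    have hlow' : ∀ i T j, k i * (if j ∈ T then D i / k i - 1 / φ else 0) ≤
        ∑ m : Fin (k i), p (e.symm ⟨i, (T, m)⟩) j := fun i T j => by
      simpa using Finset.card_nsmul_le_sum Finset.univ _ _ fun m _ => hlow i T j m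
    have hupp' : ∀ i T j, ∑ m : Fin (k i), p (e.symm ⟨i, (T, m)⟩) j ≤
        k i * ((if j ∈ T then D i / k i - 1 / φ else 0) + 1 / φ) := fun i T j => by
      simpa [mul_add] using Finset.sum_le_card_nsmul Finset.univ _ _ fun m _ => hupp i T j m
    have hmul : ∀ i, k i * (D i / k i) = D i := fun i => mul_div_cancel₀ _ (hkR i).ne'
    have hmul' : ∀ i, k i * (1 / φ) = k i / φ := fun i => by ring
    rw [paretoSetD_range_blockSol e _ p D (fun i => k i / φ)]
    · rw [← Set.image_univ, Set.ncard_image_of_injective _ (blockSol_injective hk e),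
        Set.ncard_univ]
      simp [pow_mul]
    · intro i T
      have := (hkR i).ne'
      simp [label_apply_symm]
      field_simp
    · intro i T j
      refine le_trans (mul_nonneg (hkR i).le ?_) (hlow' i T j)
      have := hDdiv i
      split_ifs <;> linarith
    · intro i T j
      refine (hupp' i T j).trans ?_
      split_ifs
      · rw [sub_add_cancel, hmul]
      · rw [zero_add, hmul']
        have : 0 < k i / φ := div_pos (hkR i) hφ0
        linarith [hD2 i]
    · intro i T j hj
      have := hlow' i T j
      rw [if_pos hj, mul_sub, hmul, hmul'] at this
      exact this
    · intro i T j hj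
      have := hupp' i T j
      rw [if_neg hj, zero_add, hmul'] at this
      exact this
    · exact hD

/-- Geometric levels with ratio `q > 2` are separated once `φ` is large. -/
lemma geometric_levels_separated {q K φ : ℝ} (hq : 2 < q) (hK : K = 4 * (q - 1) / (q - 2))
    (hφ : K ≤ φ) (i : ℕ) :
    ∑ l ∈ Finset.range i, K / φ * q ^ l + 2 * (⌈K / φ * q ^ i⌉₊ / φ) < K / φ * q ^ i := by
  have hq1 : 0 < q - 1 := by linarith
  have hq2 : 0 < q - 2 := by linarith
  have hK0 : 0 < K := by rw [hK]; positivity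
  have hφ0 : 0 < φ := hK0.trans_le hφ
  have hE : 0 < K / φ := by positivity
  set D := K / φ * q ^ i with hDdef
  have hqi : 1 ≤ q ^ i := one_le_pow₀ (by linarith)
  have hDE : K / φ ≤ D := le_mul_of_one_le_right hE.le hqi
  have hsum : ∑ l ∈ Finset.range i, K / φ * q ^ l < D / (q - 1) := by
    rw [lt_div_iff₀ hq1, ← Finset.mul_sum, mul_assoc, geom_sum_mul, hDdef]
    exact mul_lt_mul_of_pos_left (by linarith) hE
  have hceil : (⌈D⌉₊ : ℝ) ≤ D + 1 := (Nat.ceil_lt_add_one (by linarith)).le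
  have h1 : 2 * ((⌈D⌉₊ : ℝ) / φ) ≤ 2 * ((D + 1) / φ) := by gcongr
  have h2 : D / φ ≤ D / K := div_le_div_of_nonneg_left (by linarith) hK0 hφ
  have h3 : 1 / φ ≤ D / K := by
    rw [le_div_iff₀ hK0]
    calc _ = K / φ := by ring
      _ ≤ D := hDE
  have h4 : D / (q - 1) + 4 * (D / K) = D := by
    rw [hK]; field_simp; ring
  have h5 : (D + 1) / φ = D / φ + 1 / φ := add_div _ _ _
  linarith

/-- main multi-criteria lower bound. For every fixed `d ≥ 2`
there are constants `c_d, α_d, β_d > 0` such that for every `n ≥ 16d` and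
`φ ≥ 2d` there is an instance of the `(d+1)`-dimensional knapsack problem with
groups on `N ≤ n` objects, with weights `w_i` and profits `(p_i)_j` drawn
independently and uniformly from subintervals `I_{i,j} ⊆ [-1,1]` of length `1/φ`
(hence with densities bounded by `φ`), whose expected number of Pareto optimal
solutions is at least `c_d · min((nφ)^{(d - log₂ d)(1 - α_d/φ)}, 2^{β_d·n})`. -/
theorem main_multicriteria_lower_bound (d : ℕ) (hd : 2 ≤ d) :
    ∃ c α β : ℝ, 0 < c ∧ 0 < α ∧ 0 < β ∧
    ∀ n : ℕ, 16 * d ≤ n → ∀ φ : ℝ, 2 * d ≤ φ →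
    ∃ N : ℕ, N ≤ n ∧
    ∃ (S : Set (Fin N → Bool)) (w : Fin N → ℝ) (a : Fin N → Fin d → ℝ),
      (∀ i j, -1 ≤ a i j ∧ a i j + 1 / φ ≤ 1) ∧
      ENNReal.ofReal (c * min
          (((n : ℝ) * φ) ^ (((d : ℝ) - Real.logb 2 d) * (1 - α / φ)))
          ((2 : ℝ) ^ (β * n))) ≤
        ∫⁻ p : Fin N → Fin d → ℝ, ((paretoSetD S w p).ncard : ENNReal)
          ∂(Measure.pi fun i : Fin N => Measure.pi fun j : Fin d =>
              unifOn (Set.Icc (a i j) (a i j + 1 / φ))) := by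
  have hdR : (2 : ℝ) ≤ d := by exact_mod_cast hd
  set γ : ℝ := (d : ℝ) - Real.logb 2 d with hγdef
  have hlog : 0 < Real.logb 2 d := Real.logb_pos (by norm_num) (by linarith)
  have hγ : 0 < γ := by
    have : Real.logb 2 d < d := by
      rw [Real.logb_lt_iff_lt_rpow (by norm_num) (by linarith), Real.rpow_natCast]
      exact_mod_cast Nat.lt_two_pow_self
    linarith
  set q : ℝ := (2 : ℝ) ^ ((d : ℝ) / γ) with hqdef
  have hq : 2 < q := by
    have h1 : 1 < (d : ℝ) / γ := by rw [one_lt_div hγ]; linarith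
    simpa using Real.rpow_lt_rpow_of_exponent_lt (by norm_num : (1 : ℝ) < 2) h1
  have hq0 : 0 < q := by linarith
  have hqγ : q ^ γ = (2 : ℝ) ^ d := by
    rw [hqdef, ← Real.rpow_mul (by norm_num), div_mul_cancel₀ _ hγ.ne', Real.rpow_natCast]
  obtain ⟨K, hK⟩ : ∃ K : ℝ, K = 4 * (q - 1) / (q - 2) := ⟨_, rfl⟩
  have hq1 : 0 < q - 1 := by linarith
  have hq2 : 0 < q - 2 := by linarith
  have hK0 : 0 < K := by rw [hK]; positivity
  set c₁ : ℝ := 2 ^ (d + 1) * K / (q - 1) with hc₁def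
  have hc₁ : 0 < c₁ := by positivity
  have hc₁γ : 0 < c₁ ^ (-γ) := Real.rpow_pos_of_pos hc₁ _
  refine ⟨((2 : ℝ) ^ d)⁻¹ * min 1 (c₁ ^ (-γ)), K, d / 2 ^ (d + 1), by positivity, hK0,
    by positivity, ?_⟩
  intro n hn φ hφ
  have hφ1 : 1 ≤ φ := by linarith
  have hφ0 : 0 < φ := by linarith
  have hn1 : (1 : ℝ) ≤ n := by exact_mod_cast (by omega : 1 ≤ n)
  have hnφ : 1 ≤ (n : ℝ) * φ := one_le_mul_of_one_le_of_one_le hn1 hφ1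
  have hc1 : ((2 : ℝ) ^ d)⁻¹ * min 1 (c₁ ^ (-γ)) ≤ 1 :=
    mul_le_one₀ (inv_le_one_of_one_le₀ (one_le_pow₀ (by norm_num))) (by positivity)
      (min_le_left _ _)
  suffices h : ∃ (L : ℕ) (k : Fin L → ℕ) (D : Fin L → ℝ), (∀ i, 0 < k i) ∧
      (∀ i, D i ≤ k i) ∧ (∀ i, 0 ≤ D i) ∧
      (∀ i, ∑ l ∈ Finset.Iio i, D l + 2 * (k i / φ) < D i) ∧ ∑ i, 2 ^ d * k i ≤ n ∧
      ((2 : ℝ) ^ d)⁻¹ * min 1 (c₁ ^ (-γ)) * min (((n : ℝ) * φ) ^ (γ * (1 - K / φ)))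
          ((2 : ℝ) ^ (d / 2 ^ (d + 1) * (n : ℝ))) ≤ ((2 ^ (d * L) : ℕ) : ℝ) by
    obtain ⟨L, k, D, h1, h2, h3, h4, h5, h6⟩ := h
    obtain ⟨S, w, a, ha, hS⟩ := exists_instance_of_levels d L hφ1 k D h1 h2 h3 h4
    refine ⟨_, h5, S, w, a, ha, le_trans ?_ hS⟩
    rw [← ENNReal.ofReal_natCast]
    exact ENNReal.ofReal_le_ofReal h6
  rcases lt_or_ge φ K with hφK | hφK
  · refine ⟨0, Fin.elim0, Fin.elim0, fun i => i.elim0, fun i => i.elim0, fun i => i.elim0,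
      fun i => i.elim0, by simp, ?_⟩
    have hexp : γ * (1 - K / φ) ≤ 0 :=
      mul_nonpos_of_nonneg_of_nonpos hγ.le (by rw [sub_nonpos, one_le_div hφ0]; exact hφK.le)
    simpa using mul_le_one₀ hc1 (by positivity)
      ((min_le_left _ _).trans (Real.rpow_le_one_of_one_le_of_nonpos hnφ hexp))
  · set x : ℝ := min (Real.logb q (n * φ / c₁)) (n / 2 ^ (d + 1)) with hx
    have hnc : 0 < (n : ℝ) * φ / c₁ := by positivity
    set L : ℕ := ⌊x⌋₊ with hL
    have hsep := geometric_levels_separated hq hK hφK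
    refine ⟨L, fun i => ⌈K / φ * q ^ (i : ℕ)⌉₊, fun i => K / φ * q ^ (i : ℕ),
      fun i => Nat.ceil_pos.mpr (by positivity), fun i => Nat.le_ceil _,
      fun i => by positivity, fun i => ?_, ?_, ?_⟩
    · rw [sum_Iio_fin i fun l => K / φ * q ^ l]
      exact hsep i
    · rcases Nat.eq_zero_or_pos L with h0 | hpos
      · have : IsEmpty (Fin L) := by rw [h0]; infer_instance
        simp
      · have hLx : (L : ℝ) ≤ x := Nat.floor_le ((Nat.floor_pos.mp hpos).trans' zero_le_one)
        have hqL : q ^ L ≤ n * φ / c₁ := by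
          rw [← Real.rpow_natCast, ← Real.le_logb_iff_rpow_le (by linarith) hnc]
          exact hLx.trans (min_le_left _ _)
        have hLn : (L : ℝ) ≤ n / 2 ^ (d + 1) := hLx.trans (min_le_right _ _)
        have hceil : ∀ i ∈ (Finset.univ : Finset (Fin L)),
            (2 : ℝ) ^ d * (⌈K / φ * q ^ (i : ℕ)⌉₊ : ℝ) ≤
              2 ^ d * (K / φ * q ^ (i : ℕ) + 1) := fun i _ => by
          gcongr
          exact (Nat.ceil_lt_add_one (by positivity)).le
        have hsum := Finset.sum_le_sum hceil
        rw [← Finset.mul_sum Finset.univ (fun i : Fin L => K / φ * q ^ (i : ℕ) + 1),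
          Finset.sum_add_distrib,
          ← Finset.mul_sum Finset.univ (fun i : Fin L => q ^ (i : ℕ)), Fin.sum_univ_eq_sum_range (fun i => q ^ i),
          geom_sum_eq (by linarith)] at hsum
        simp only [Finset.sum_const, Finset.card_univ, Fintype.card_fin, nsmul_eq_mul,
          mul_one] at hsum
        have h1 : (2 : ℝ) ^ d * (K / φ * ((q ^ L - 1) / (q - 1))) ≤ n / 2 := by
          calc (2 : ℝ) ^ d * (K / φ * ((q ^ L - 1) / (q - 1)))
              ≤ 2 ^ d * (K / φ * ((n * φ / c₁) / (q - 1))) := by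
                gcongr; linarith
            _ = n / 2 := by
                rw [hc₁def, pow_succ]; field_simp
        have h2 : (2 : ℝ) ^ d * L ≤ n / 2 := by
          calc (2 : ℝ) ^ d * L ≤ 2 ^ d * (n / 2 ^ (d + 1)) := by gcongr
            _ = n / 2 := by rw [pow_succ]; field_simp
        have : ((∑ i : Fin L, 2 ^ d * ⌈K / φ * q ^ (i : ℕ)⌉₊ : ℕ) : ℝ) ≤ n := by
          push_cast
          linarith
        exact_mod_cast this
    · have hLx : x - 1 ≤ L := by linarith [Nat.lt_floor_add_one x]
      have hcount : ((2 ^ (d * L) : ℕ) : ℝ) = q ^ (γ * (L : ℝ)) := by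
        rw [Real.rpow_mul hq0.le, hqγ, Real.rpow_natCast]
        push_cast
        rw [pow_mul]
      have hqx : min 1 (c₁ ^ (-γ)) * min (((n : ℝ) * φ) ^ (γ * (1 - K / φ)))
          ((2 : ℝ) ^ (d / 2 ^ (d + 1) * (n : ℝ))) ≤ q ^ (γ * x) := by
        rcases min_choice (Real.logb q (n * φ / c₁)) ((n : ℝ) / 2 ^ (d + 1)) with h | h
        · rw [hx, h, mul_comm γ (Real.logb _ _), Real.rpow_mul hq0.le,
            Real.rpow_logb hq0 (by linarith) hnc, div_eq_mul_inv (_ * φ), mul_comm _ c₁⁻¹,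
            Real.mul_rpow (inv_nonneg.mpr hc₁.le) (by positivity), Real.inv_rpow hc₁.le,
            ← Real.rpow_neg hc₁.le]
          refine mul_le_mul (min_le_right _ _) ((min_le_left _ _).trans ?_) (by positivity)
            (by positivity)
          refine Real.rpow_le_rpow_of_exponent_le hnφ (mul_le_of_le_one_right hγ.le ?_)
          have : 0 < K / φ := by positivity
          linarith
        · rw [hx, h, Real.rpow_mul hq0.le, hqγ, ← Real.rpow_natCast_mul (by norm_num)]
          calc _ ≤ 1 * (2 : ℝ) ^ (d / 2 ^ (d + 1) * (n : ℝ)) :=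
                mul_le_mul (min_le_left _ _) (min_le_right _ _) (by positivity) zero_le_one
            _ = _ := by rw [one_mul]; congr 1; ring
      rw [hcount, mul_assoc, inv_mul_le_iff₀ (by positivity), ← hqγ, ← Real.rpow_add hq0]
      refine hqx.trans (Real.rpow_le_rpow_of_exponent_le (by linarith) ?_)
      nlinarith
end

section
/- There is a constant c > 0 such that for every positive integer n the following holds. Let a_1,...,a_n be objects with weights 2^1,...,2^n and profits p_1,...,p_n drawn independently and uniformly from [0,1]. Then the expected number of Pareto optimal solutions of the bi-criteria knapsack problem K({a_1,...,a_n}) with solution set {0,1}^n is at least c·n². -/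
open MeasureTheory Finset

/-- The weights `2^1,…,2^n`. -/
def powWeights (n : ℕ) (i : Fin n) : ℝ := (2 : ℝ) ^ ((i : ℕ) + 1)

lemma totalVal_succ {n : ℕ} (w : Fin (n + 1) → ℝ) (s : Fin (n + 1) → Bool) :
    totalVal w s = totalVal (fun i : Fin n => w i.castSucc) (fun i : Fin n => s i.castSucc) +
      if s (Fin.last n) then w (Fin.last n) else 0 := by
  simp only [totalVal, Fin.sum_univ_castSucc]

lemma totalVal_powWeights_succ {n : ℕ} (s : Fin (n + 1) → Bool) :
    totalVal (powWeights (n + 1)) s = totalVal (powWeights n) (fun i : Fin n => s i.castSucc) +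
      if s (Fin.last n) then (2 : ℝ) ^ (n + 1) else 0 := by
  rw [totalVal_succ]
  rfl

lemma totalVal_powWeights_nonneg {n : ℕ} (s : Fin n → Bool) :
    0 ≤ totalVal (powWeights n) s := by
  refine Finset.sum_nonneg fun i _ => ?_
  unfold powWeights
  split_ifs <;> positivity

lemma totalVal_powWeights_lt {n : ℕ} (s : Fin n → Bool) :
    totalVal (powWeights n) s < 2 ^ (n + 1) := by
  induction n with
  | zero => simp [totalVal]
  | succ n ih =>
    rw [totalVal_powWeights_succ]
    have h := ih fun i => s i.castSucc
    have h2 : (0 : ℝ) < 2 ^ (n + 1) := by positivity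
    have h3 : (2 : ℝ) ^ (n + 1 + 1) = 2 * 2 ^ (n + 1) := by ring
    split_ifs <;> linarith

/-- Pareto optimal solutions whose profit is within `x` of every attainable profit. -/
def nearOptimal {n : ℕ} (x : ℝ) (p : Fin n → ℝ) : Set (Fin n → Bool) :=
  {s ∈ paretoSet Set.univ (powWeights n) p | ∀ t, totalVal p t < totalVal p s + x}

lemma snoc_false_mem_nearOptimal {n : ℕ} {x : ℝ} {p : Fin (n + 1) → ℝ} {s : Fin n → Bool}
    (hs : s ∈ nearOptimal (x - |p (Fin.last n)|) (fun i => p i.castSucc)) :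
    (Fin.snoc s false : Fin (n + 1) → Bool) ∈ nearOptimal x p := by
  obtain ⟨⟨-, hs⟩, hx⟩ := hs
  refine ⟨⟨trivial, fun t _ ht => ?_⟩, fun t => ?_⟩
  · simp only [dominates, totalVal_powWeights_succ, totalVal_succ p, Fin.snoc_castSucc,
      Fin.snoc_last] at ht
    by_cases hl : t (Fin.last n) = true
    · have h1 := totalVal_powWeights_lt s
      have h2 := totalVal_powWeights_nonneg fun i => t i.castSucc
      simp only [hl, if_true] at ht
      have := ht.1
      simp only [Bool.false_eq_true, if_false] at this
      linarith
    · refine hs (fun i => t i.castSucc) trivial ?_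
      simpa [hl, dominates] using ht
  · have h := hx fun i => t i.castSucc
    rw [totalVal_succ, totalVal_succ p (Fin.snoc s false)]
    simp only [Fin.snoc_castSucc, Fin.snoc_last, Bool.false_eq_true, if_false]
    have h1 := le_abs_self (p (Fin.last n))
    have h2 := abs_nonneg (p (Fin.last n))
    split_ifs <;> linarith

lemma snoc_true_mem_nearOptimal {n : ℕ} {x : ℝ} {p : Fin (n + 1) → ℝ} {s : Fin n → Bool}
    (hs : s ∈ nearOptimal (min x (p (Fin.last n))) (fun i => p i.castSucc)) :
    (Fin.snoc s true : Fin (n + 1) → Bool) ∈ nearOptimal x p := by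
  obtain ⟨⟨-, hs⟩, hx⟩ := hs
  have hxl := min_le_left x (p (Fin.last n))
  have hxr := min_le_right x (p (Fin.last n))
  have hpos := hx s
  refine ⟨⟨trivial, fun t _ ht => ?_⟩, fun t => ?_⟩
  · simp only [dominates, totalVal_powWeights_succ, totalVal_succ p, Fin.snoc_castSucc,
      Fin.snoc_last, if_true] at ht
    by_cases hl : t (Fin.last n) = true
    · refine hs (fun i => t i.castSucc) trivial ?_
      simpa [hl, dominates] using ht
    · have h1 := ht.2.1
      simp only [hl, Bool.false_eq_true, if_false] at h1
      have h2 := hx fun i => t i.castSucc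
      linarith
  · have h := hx fun i => t i.castSucc
    rw [totalVal_succ, totalVal_succ p (Fin.snoc s true)]
    simp only [Fin.snoc_castSucc, Fin.snoc_last, if_true]
    split_ifs <;> linarith

lemma ncard_nearOptimal_succ {n : ℕ} (x : ℝ) (p : Fin (n + 1) → ℝ) :
    (nearOptimal (min x (p (Fin.last n))) (fun i => p i.castSucc)).ncard +
      (nearOptimal (x - |p (Fin.last n)|) (fun i => p i.castSucc)).ncard ≤
    (nearOptimal x p).ncard := by
  have hinj : ∀ b : Bool, Function.Injective
      fun s : Fin n → Bool => (Fin.snoc s b : Fin (n + 1) → Bool) := fun b s t h => by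
    funext i
    simpa using congrFun h i.castSucc
  rw [← Set.ncard_image_of_injective _ (hinj true),
    ← Set.ncard_image_of_injective
      (nearOptimal (x - |p (Fin.last n)|) fun i => p i.castSucc) (hinj false),
    ← Set.ncard_union_eq ?_ (Set.toFinite _) (Set.toFinite _)]
  · refine Set.ncard_le_ncard ?_ (Set.toFinite _)
    rintro _ (⟨s, hs, rfl⟩ | ⟨s, hs, rfl⟩)
    · exact snoc_true_mem_nearOptimal hs
    · exact snoc_false_mem_nearOptimal hs
  · rw [Set.disjoint_left]
    rintro _ ⟨s, -, rfl⟩ ⟨t, -, h⟩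
    simpa using congrFun h (Fin.last n)

/-- A measurable lower bound for the number of near-optimal Pareto solutions. -/
noncomputable def nearCount : (n : ℕ) → ℝ → (Fin n → ℝ) → ENNReal
  | 0, x, _ => if 0 < x then 1 else 0
  | n + 1, x, p =>
    nearCount n (min x (p (Fin.last n))) (fun i => p i.castSucc) +
      nearCount n (x - |p (Fin.last n)|) (fun i => p i.castSucc)

lemma nearCount_le (n : ℕ) (x : ℝ) (p : Fin n → ℝ) :
    nearCount n x p ≤ ((nearOptimal x p).ncard : ENNReal) := by
  induction n generalizing x with
  | zero =>
    rw [nearCount]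
    split_ifs with hx
    · have : nearOptimal x p = Set.univ := by
        refine Set.eq_univ_of_forall fun s => ⟨⟨trivial, fun t _ ht => ?_⟩, fun t => ?_⟩
        · simp [dominates, totalVal] at ht
        · simpa [totalVal] using hx
      simp [this, Set.ncard_univ]
    · exact zero_le
  | succ n ih =>
    rw [nearCount]
    refine (add_le_add (ih _ _) (ih _ _)).trans ?_
    exact_mod_cast ncard_nearOptimal_succ x p

lemma measurable_nearCount (n : ℕ) :
    Measurable fun z : ℝ × (Fin n → ℝ) => nearCount n z.1 z.2 := by
  induction n with
  | zero =>
    simp only [nearCount]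
    exact Measurable.ite (measurableSet_lt measurable_const measurable_fst)
      measurable_const measurable_const
  | succ n ih =>
    simp only [nearCount]
    refine (ih.comp (f := fun z : ℝ × (Fin (n + 1) → ℝ) =>
      (min z.1 (z.2 (Fin.last n)), fun i : Fin n => z.2 i.castSucc)) ?_).add
      (ih.comp (f := fun z : ℝ × (Fin (n + 1) → ℝ) =>
        (z.1 - |z.2 (Fin.last n)|, fun i : Fin n => z.2 i.castSucc)) ?_)
    · fun_prop
    · fun_prop

lemma unifOn_Icc_zero_one : unifOn (Set.Icc 0 1) = volume.restrict (Set.Icc (0 : ℝ) 1) := by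
  simp [unifOn]

instance : IsProbabilityMeasure (unifOn (Set.Icc 0 1)) :=
  ⟨by simp [unifOn_Icc_zero_one]⟩

/-- Expectation of `nearCount` under independent uniform profits. -/
noncomputable def expNearCount (n : ℕ) (x : ℝ) : ENNReal :=
  ∫⁻ p, nearCount n x p ∂(Measure.pi fun _ : Fin n => unifOn (Set.Icc 0 1))

lemma expNearCount_succ (n : ℕ) (x : ℝ) :
    expNearCount (n + 1) x =
      ∫⁻ q in Set.Icc (0 : ℝ) 1, (expNearCount n (min x q) + expNearCount n (x - |q|)) := by
  have hmp := measurePreserving_piFinSuccAbove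
    (fun _ : Fin (n + 1) => unifOn (Set.Icc 0 1)) (Fin.last n)
  have h1 : Measurable fun z : ℝ × (Fin n → ℝ) => nearCount n (min x z.1) z.2 :=
    (measurable_nearCount n).comp (f := fun z : ℝ × (Fin n → ℝ) => (min x z.1, z.2))
      (by fun_prop)
  have h2 : Measurable fun z : ℝ × (Fin n → ℝ) => nearCount n (x - |z.1|) z.2 :=
    (measurable_nearCount n).comp (f := fun z : ℝ × (Fin n → ℝ) => (x - |z.1|, z.2))
      (by fun_prop)
  have key := hmp.lintegral_comp (h1.add h2)
  rw [lintegral_prod _ (h1.add h2).aemeasurable] at key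
  have hR : (volume.restrict (Set.Icc (0 : ℝ) 1)) = unifOn (Set.Icc 0 1) :=
    unifOn_Icc_zero_one.symm
  rw [hR, expNearCount]
  refine Eq.trans ?_ (key.trans (lintegral_congr fun q => ?_))
  · refine lintegral_congr fun p => ?_
    simp [nearCount, MeasurableEquiv.piFinSuccAbove]
    rfl
  · simp only [Pi.add_apply]
    exact lintegral_add_left (h1.comp measurable_prodMk_left) _

lemma le_expNearCount (n : ℕ) {x : ℝ} (hx0 : 0 < x) (hx1 : x ≤ 1) :
    ENNReal.ofReal (1 + n * x) ≤ expNearCount n x := by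
  induction n generalizing x with
  | zero => simp [expNearCount, nearCount, hx0]
  | succ n ih =>
    rw [expNearCount_succ]
    have hsub : Set.Ioo 0 x ∪ Set.Icc x 1 ⊆ Set.Icc (0 : ℝ) 1 := by
      rintro q (⟨h, h'⟩ | ⟨h, h'⟩) <;> constructor <;> linarith
    have hdisj : Disjoint (Set.Ioo 0 x) (Set.Icc x 1) :=
      Set.disjoint_left.2 fun q h h' => absurd h.2 (not_lt.2 h'.1)
    refine le_trans ?_ (lintegral_mono_set hsub)
    rw [lintegral_union measurableSet_Icc hdisj]
    have h1 : ∫⁻ _ in Set.Ioo 0 x, ENNReal.ofReal (2 + n * x) ≤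
        ∫⁻ q in Set.Ioo 0 x, (expNearCount n (min x q) + expNearCount n (x - |q|)) := by
      refine setLIntegral_mono' measurableSet_Ioo fun q hq => ?_
      rw [min_eq_right hq.2.le, abs_of_pos hq.1]
      refine le_trans (le_of_eq ?_) (add_le_add (ih hq.1 (hq.2.le.trans hx1))
        (ih (sub_pos.2 hq.2) (by linarith [hq.1])))
      have := hq.1
      have := sub_pos.2 hq.2
      rw [← ENNReal.ofReal_add (by positivity) (by positivity)]
      congr 1
      ring
    have h2 : ∫⁻ _ in Set.Icc x 1, ENNReal.ofReal (1 + n * x) ≤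
        ∫⁻ q in Set.Icc x 1, (expNearCount n (min x q) + expNearCount n (x - |q|)) := by
      refine setLIntegral_mono' measurableSet_Icc fun q hq => ?_
      rw [min_eq_left hq.1]
      exact (ih hx0 hx1).trans le_self_add
    refine le_trans (le_of_eq ?_) (add_le_add h1 h2)
    have hx1' := sub_nonneg.2 hx1
    simp only [setLIntegral_const, Real.volume_Ioo, Real.volume_Icc, sub_zero]
    rw [← ENNReal.ofReal_mul (by positivity), ← ENNReal.ofReal_mul (by positivity),
      ← ENNReal.ofReal_add (by positivity) (by positivity)]
    congr 1
    push_cast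
    ring

lemma sq_div_four_le_expNearCount (n : ℕ) {x : ℝ} (hx : (n : ℝ) ≤ x) :
    ENNReal.ofReal ((1 / 4 : ℝ) * n ^ 2) ≤ expNearCount n x := by
  induction n generalizing x with
  | zero => simp
  | succ n ih =>
    push_cast at hx
    have hn : (0 : ℝ) ≤ n := n.cast_nonneg
    rw [expNearCount_succ]
    have h : ∫⁻ q in Set.Ioc (0 : ℝ) 1, ENNReal.ofReal (1 + n * q + (1 / 4 : ℝ) * n ^ 2) ≤
        ∫⁻ q in Set.Icc (0 : ℝ) 1, (expNearCount n (min x q) + expNearCount n (x - |q|)) := by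
      refine le_trans ?_ (lintegral_mono_set Set.Ioc_subset_Icc_self)
      refine setLIntegral_mono' measurableSet_Ioc fun q hq => ?_
      have hq0 := hq.1
      have hq1 := hq.2
      rw [min_eq_right (by linarith), abs_of_pos hq0,
        ENNReal.ofReal_add (by positivity) (by positivity)]
      exact add_le_add (le_expNearCount n hq0 hq1) (ih (by linarith))
    refine le_trans ?_ h
    have hcont : Continuous fun q : ℝ => 1 + n * q + (1 / 4 : ℝ) * n ^ 2 := by fun_prop
    rw [← ofReal_integral_eq_lintegral_ofReal]
    · refine ENNReal.ofReal_le_ofReal ?_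
      rw [← intervalIntegral.integral_of_le zero_le_one,
        intervalIntegral.integral_add (Continuous.intervalIntegrable (by fun_prop) _ _)
          (Continuous.intervalIntegrable (by fun_prop) _ _),
        intervalIntegral.integral_add (Continuous.intervalIntegrable (by fun_prop) _ _)
          (Continuous.intervalIntegrable (by fun_prop) _ _),
        intervalIntegral.integral_const_mul]
      simp only [intervalIntegral.integral_const, integral_id]
      push_cast
      norm_num
      nlinarith
    · exact (hcont.integrableOn_Icc).mono_set Set.Ioc_subset_Icc_self
    · filter_upwards [ae_restrict_mem measurableSet_Ioc] with q hq
      have := hq.1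
      simp only [Pi.zero_apply]
      positivity

/-- Beier–Vöcking. There is a constant `c > 0` such that for
every `n ≥ 1`, with weights `2^1,…,2^n` and profits drawn independently and
uniformly from `[0,1]`, the expected number of Pareto optimal solutions of
`K({a_1,…,a_n})` is at least `c·n²`. -/
theorem beier_voecking_lower_bound : ∃ c : ℝ, 0 < c ∧
    ∀ n : ℕ, 0 < n →
      ENNReal.ofReal (c * n ^ 2) ≤
        ∫⁻ p : Fin n → ℝ,
          ((paretoSet Set.univ (fun i : Fin n => (2 : ℝ) ^ ((i : ℕ) + 1))
              p).ncard : ENNReal)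
          ∂(Measure.pi fun _ : Fin n => unifOn (Set.Icc 0 1)) := by
  refine ⟨1 / 4, by norm_num, fun n _ => ?_⟩
  refine (sq_div_four_le_expNearCount n le_rfl).trans (lintegral_mono fun p => ?_)
  refine (nearCount_le n n p).trans ?_
  exact Nat.cast_le.2 (Set.ncard_le_ncard (Set.sep_subset _ _) (Set.toFinite _))
end
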